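/- Let F : C ⇄ D : G be a Quillen adjunction and double-point the collage (C^c+D) by objects x ∈ C^c and y ∈ D (so the target point lies in the fiber D). Let I be a decorated doubly-pointed model diagram and let a be an object of I connected to t by a zigzag of morphisms of W_I. Let J be the decorated doubly-pointed model diagram obtained from I by freely adjoining one new object u, marked 'fibrant', together with a morphism a → u lying in W_J ∩ C_J. Then restriction along the inclusion I → J induces a weak homotopy equivalence N(Fun*_{**}(J,(C^c+D))^W) → N(Fun*_{**}(I,(C^c+D))^W). -/

import Mathlib

open CategoryTheory CategoryTheory.Limits

universe w v u

namespace Paper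

open Simplicial in
/-- The map constant at vertex `i` of `Δ[1]`. -/
def constVertex (X : SSet.{w}) (i : Fin 2) : X ⟶ Δ[1] where
  app m := ↾fun _ => ULift.up (SimplexCategory.const m.unop ⦋1⦌ i)
  naturality _ _ _ := by ext _; rfl

open Simplicial in
/-- Elementary simplicial homotopy between two maps of simplicial sets,
given by a map out of the cylinder `X ⨯ Δ[1]`. -/
def SHomotopy {X Y : SSet.{w}} (f g : X ⟶ Y) : Prop :=
  ∃ H : X ⨯ Δ[1] ⟶ Y,
    prod.lift (𝟙 X) (constVertex X 0) ≫ H = f ∧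
    prod.lift (𝟙 X) (constVertex X 1) ≫ H = g

/-- The relation of being simplicially homotopic: the equivalence relation
generated by elementary simplicial homotopies. -/
def Htpy {X Y : SSet.{w}} (f g : X ⟶ Y) : Prop := Relation.EqvGen SHomotopy f g

open Simplicial in
/-- A simplicial set `S` is a *Kan complex* if it satisfies the following horn-filling condition:
for every `n : ℕ` and `0 ≤ i ≤ n`,
every map of simplicial sets `σ₀ : Λ[n, i] → S` can be extended to a map `σ : Δ[n] → S`. -/
class KanComplex (S : SSet.{w}) : Prop where
  hornFilling : ∀ ⦃n : ℕ⦄ ⦃i : Fin (n + 1)⦄ (σ₀ : (Λ[n, i] : SSet.{w}) ⟶ S),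
    ∃ σ : Δ[n] ⟶ S, σ₀ = Λ[n, i].ι ≫ σ

/-- A map of simplicial sets is a weak homotopy equivalence (in the Kan–Quillen sense)
iff for every Kan complex `K` the induced map on simplicial homotopy classes of maps
into `K` is a bijection. -/
def IsWeakHomotopyEquiv {X Y : SSet.{w}} (f : X ⟶ Y) : Prop :=
  ∀ (K : SSet.{w}), KanComplex K →
    (∀ g : X ⟶ K, ∃ h : Y ⟶ K, Htpy (f ≫ h) g) ∧
    (∀ h h' : Y ⟶ K, Htpy (f ≫ h) (f ≫ h') → Htpy h h')

/-- A simplicial set is weakly contractible if its map to the terminal object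
is a weak homotopy equivalence. -/
def WeaklyContractible (X : SSet.{w}) : Prop := IsWeakHomotopyEquiv (terminal.from X)

/-- The map on nerves induced by a functor. -/
def nerveMap {C : Type u} {D : Type u} [Category.{v} C] [Category.{v} D] (F : C ⥤ D) :
    nerve C ⟶ nerve D where
  app _ := ↾fun G => G ⋙ F
  naturality _ _ _ := by ext _; rfl



/-- `f` is a retract of `g` in the arrow category. -/
def IsRetractOf {C : Type u} [Category.{v} C] {X Y X' Y' : C} (f : X ⟶ Y) (g : X' ⟶ Y') : Prop :=
  ∃ (i : X ⟶ X') (r : X' ⟶ X) (j : Y ⟶ Y') (s : Y' ⟶ Y),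
    i ≫ r = 𝟙 X ∧ j ≫ s = 𝟙 Y ∧ i ≫ g = f ≫ j ∧ r ≫ f = g ≫ s

/-- A (Quillen) model structure on a category: three wide subcategories of weak
equivalences, cofibrations and fibrations, satisfying the two-out-of-three, retract,
lifting and factorization axioms.  (No functorial factorizations are assumed; a model
category is a finitely bicomplete category equipped with such a structure.) -/
structure ModelStructure (C : Type u) [Category.{v} C] where
  W : MorphismProperty C
  Cof : MorphismProperty C
  Fib : MorphismProperty C
  W_id : ∀ X : C, W (𝟙 X)
  Cof_id : ∀ X : C, Cof (𝟙 X)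
  Fib_id : ∀ X : C, Fib (𝟙 X)
  W_comp : ∀ {X Y Z : C} (f : X ⟶ Y) (g : Y ⟶ Z), W f → W g → W (f ≫ g)
  Cof_comp : ∀ {X Y Z : C} (f : X ⟶ Y) (g : Y ⟶ Z), Cof f → Cof g → Cof (f ≫ g)
  Fib_comp : ∀ {X Y Z : C} (f : X ⟶ Y) (g : Y ⟶ Z), Fib f → Fib g → Fib (f ≫ g)
  W_of_precomp : ∀ {X Y Z : C} (f : X ⟶ Y) (g : Y ⟶ Z), W f → W (f ≫ g) → W g
  W_of_postcomp : ∀ {X Y Z : C} (f : X ⟶ Y) (g : Y ⟶ Z), W g → W (f ≫ g) → W f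
  W_retract : ∀ {X Y X' Y' : C} {f : X ⟶ Y} {g : X' ⟶ Y'}, IsRetractOf f g → W g → W f
  Cof_retract : ∀ {X Y X' Y' : C} {f : X ⟶ Y} {g : X' ⟶ Y'}, IsRetractOf f g → Cof g → Cof f
  Fib_retract : ∀ {X Y X' Y' : C} {f : X ⟶ Y} {g : X' ⟶ Y'}, IsRetractOf f g → Fib g → Fib f
  lifting_acof_fib : ∀ {A B X Y : C} (i : A ⟶ B) (p : X ⟶ Y),
    Cof i → W i → Fib p → HasLiftingProperty i p
  lifting_cof_afib : ∀ {A B X Y : C} (i : A ⟶ B) (p : X ⟶ Y),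
    Cof i → Fib p → W p → HasLiftingProperty i p
  fact_acof_fib : ∀ {X Y : C} (f : X ⟶ Y),
    ∃ (Z : C) (i : X ⟶ Z) (p : Z ⟶ Y), Cof i ∧ W i ∧ Fib p ∧ i ≫ p = f
  fact_cof_afib : ∀ {X Y : C} (f : X ⟶ Y),
    ∃ (Z : C) (i : X ⟶ Z) (p : Z ⟶ Y), Cof i ∧ Fib p ∧ W p ∧ i ≫ p = f

/-- An object is cofibrant if the map from an initial object is a cofibration. -/
def Cofibrant {C : Type u} [Category.{v} C] [HasInitial C] (M : ModelStructure C) (X : C) :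
    Prop := M.Cof (initial.to X)

/-- An object is fibrant if the map to a terminal object is a fibration. -/
def Fibrant {C : Type u} [Category.{v} C] [HasTerminal C] (M : ModelStructure C) (X : C) :
    Prop := M.Fib (terminal.from X)

/-- A category with a wide subcategory of weak equivalences (a relative category
whose weak equivalences form a wide subcategory). -/
structure RelCatStruct (R : Type u) [Category.{v} R] where
  W : MorphismProperty R
  W_id : ∀ X : R, W (𝟙 X)
  W_comp : ∀ {X Y Z : R} (f : X ⟶ Y) (g : Y ⟶ Z), W f → W g → W (f ≫ g)

/-- The underlying relative category of a model structure. -/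
def ModelStructure.relcat {C : Type u} [Category.{v} C] (M : ModelStructure C) :
    RelCatStruct C :=
  ⟨M.W, M.W_id, M.W_comp⟩

/-- A Quillen adjunction between model categories: an adjunction `F ⊣ G` such that
`F` preserves cofibrations and acyclic cofibrations. -/
structure QuillenAdjunction {C : Type u} {D : Type u} [Category.{v} C] [Category.{v} D]
    (MC : ModelStructure C) (MD : ModelStructure D) where
  F : C ⥤ D
  G : D ⥤ C
  adj : F ⊣ G
  F_cof : ∀ {X Y : C} (f : X ⟶ Y), MC.Cof f → MD.Cof (F.map f)
  F_acof : ∀ {X Y : C} (f : X ⟶ Y), MC.Cof f → MC.W f → MD.W (F.map f)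

section Collage

variable {C : Type u} {D : Type u} [Category.{v} C] [Category.{v} D]

/-- The objects of the collage of an adjunction `F ⊣ G` relative to predicates `PC`, `PD`:
the objects of `C` satisfying `PC` together with the objects of `D` satisfying `PD`. -/
def Collage (_ : D ⥤ C) (PC : C → Prop) (PD : D → Prop) : Type u :=
  {x : C // PC x} ⊕ {y : D // PD y}

/-- Hom-sets of the collage: morphisms of `C` on the left, morphisms of `D` on the right,
bridge morphisms `hom(x,y) = hom_C(x, G(y))` from left to right, and no morphisms from
right to left. -/
def CollageHom (G : D ⥤ C) (PC : C → Prop) (PD : D → Prop) :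
    Collage G PC PD → Collage G PC PD → Type v
  | Sum.inl x, Sum.inl x' => x.1 ⟶ x'.1
  | Sum.inl x, Sum.inr y => x.1 ⟶ G.obj y.1
  | Sum.inr y, Sum.inr y' => y.1 ⟶ y'.1
  | Sum.inr _, Sum.inl _ => PEmpty.{v + 1}

instance {G : D ⥤ C} {PC : C → Prop} {PD : D → Prop} : Category (Collage G PC PD) where
  Hom := CollageHom G PC PD
  id a := match a with
    | Sum.inl x => (𝟙 x.1 : x.1 ⟶ x.1)
    | Sum.inr y => (𝟙 y.1 : y.1 ⟶ y.1)
  comp {a b c} f g := match a, b, c, f, g with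
    | Sum.inl _, Sum.inl _, Sum.inl _, f, g => f ≫ g
    | Sum.inl _, Sum.inl _, Sum.inr _, f, g => f ≫ g
    | Sum.inl _, Sum.inr _, Sum.inr _, f, g => f ≫ G.map g
    | Sum.inr _, Sum.inr _, Sum.inr _, f, g => f ≫ g
    | Sum.inl _, Sum.inr _, Sum.inl _, _, g => g.elim
    | Sum.inr _, Sum.inl _, _, f, _ => f.elim
    | Sum.inr _, Sum.inr _, Sum.inl _, _, g => g.elim
  id_comp {a b} f := by
    rcases a with x|y <;> rcases b with x'|y' <;>
      first
        | exact f.elim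
        | exact Category.id_comp (obj := C) _
        | exact Category.id_comp (obj := D) _
  comp_id {a b} f := by
    rcases a with x|y <;> rcases b with x'|y' <;>
      first
        | exact f.elim
        | exact Category.comp_id (obj := C) _
        | exact Category.comp_id (obj := D) _
        | exact (congrArg (fun k => CategoryStruct.comp (X := x.1) (Y := G.obj y'.1)
            (Z := G.obj y'.1) f k) (G.map_id y'.1)).trans (Category.comp_id (obj := C) _)
  assoc {a b c d} f g h := by
    rcases a with xa|ya <;> rcases b with xb|yb <;> rcases c with xc|yc <;>
      rcases d with xd|yd <;>
      first
        | exact f.elim | exact g.elim | exact h.elim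
        | exact Category.assoc (obj := C) _ _ _
        | exact Category.assoc (obj := D) _ _ _
        | exact (Category.assoc (obj := C) _ _ _).trans
            (congrArg (fun k => CategoryStruct.comp (X := xa.1) (Y := G.obj yb.1)
              (Z := G.obj yd.1) f k)
              (G.map_comp (X := yb.1) (Y := yc.1) (Z := yd.1) g h).symm)

/-- The weak equivalences of the collage: those of the two fibers; no bridge morphism is
a weak equivalence. -/
def collW (G : D ⥤ C) (PC : C → Prop) (PD : D → Prop)
    (WC : MorphismProperty C) (WD : MorphismProperty D) :
    MorphismProperty (Collage G PC PD) := fun a b f =>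
  match a, b, f with
  | Sum.inl _, Sum.inl _, f => WC f
  | Sum.inr _, Sum.inr _, f => WD f
  | Sum.inl _, Sum.inr _, _ => False
  | Sum.inr _, Sum.inl _, _ => False

/-- The collage of a Quillen adjunction as a relative category. -/
def collageRel {MC : ModelStructure C} {MD : ModelStructure D}
    (Q : QuillenAdjunction MC MD) (PC : C → Prop) (PD : D → Prop) :
    RelCatStruct (Collage Q.G PC PD) where
  W := collW Q.G PC PD MC.W MD.W
  W_id X := by
    rcases X with x|y
    · exact MC.W_id x.1
    · exact MD.W_id y.1
  W_comp {X Y Z} f g hf hg := by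
    rcases X with x|y <;> rcases Y with x'|y' <;> rcases Z with x''|y'' <;>
      first
        | exact f.elim | exact g.elim | exact hf.elim | exact hg.elim
        | exact MC.W_comp f g hf hg
        | exact MD.W_comp f g hf hg

end Collage

/-- Transporting a component of a natural transformation along an equality of objects. -/
lemma natTrans_app_congr {J E : Type u} [Category.{v} J] [Category.{v} E]
    {F G : J ⥤ E} (η : F ⟶ G) {p q : J} (e : p = q) :
    η.app p = eqToHom (by rw [e]) ≫ η.app q ≫ eqToHom (by rw [e]) := by
  subst e; simp

section ModelDiagrams

/-- A model diagram: a category equipped with three wide subcategories `W`, `C`, `F`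
such that `W` satisfies the two-out-of-three axiom. -/
structure ModelDiag (I : Type u) [Category.{v} I] where
  W : MorphismProperty I
  C : MorphismProperty I
  F : MorphismProperty I
  W_id : ∀ X : I, W (𝟙 X)
  C_id : ∀ X : I, C (𝟙 X)
  F_id : ∀ X : I, F (𝟙 X)
  W_comp : ∀ {X Y Z : I} (f : X ⟶ Y) (g : Y ⟶ Z), W f → W g → W (f ≫ g)
  C_comp : ∀ {X Y Z : I} (f : X ⟶ Y) (g : Y ⟶ Z), C f → C g → C (f ≫ g)
  F_comp : ∀ {X Y Z : I} (f : X ⟶ Y) (g : Y ⟶ Z), F f → F g → F (f ≫ g)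
  W_of_precomp : ∀ {X Y Z : I} (f : X ⟶ Y) (g : Y ⟶ Z), W f → W (f ≫ g) → W g
  W_of_postcomp : ∀ {X Y Z : I} (f : X ⟶ Y) (g : Y ⟶ Z), W g → W (f ≫ g) → W f

/-- A model category is a model diagram via its weak equivalences, cofibrations and
fibrations. -/
def ModelStructure.diag {C : Type u} [Category.{v} C] (M : ModelStructure C) :
    ModelDiag C where
  W := M.W
  C := M.Cof
  F := M.Fib
  W_id := M.W_id
  C_id := M.Cof_id
  F_id := M.Fib_id
  W_comp := M.W_comp
  C_comp := M.Cof_comp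
  F_comp := M.Fib_comp
  W_of_precomp := M.W_of_precomp
  W_of_postcomp := M.W_of_postcomp

variable {I : Type u} {J : Type u} {E : Type u}
  [Category.{v} I] [Category.{v} J] [Category.{v} E]

/-- A morphism of model diagrams: a functor preserving each of the three wide
subcategories. -/
structure MDHom (MI : ModelDiag I) (ME : ModelDiag E) where
  func : I ⥤ E
  map_W : ∀ {X Y : I} (f : X ⟶ Y), MI.W f → ME.W (func.map f)
  map_C : ∀ {X Y : I} (f : X ⟶ Y), MI.C f → ME.C (func.map f)
  map_F : ∀ {X Y : I} (f : X ⟶ Y), MI.F f → ME.F (func.map f)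

/-- Composition of morphisms of model diagrams. -/
def MDHom.comp {MI : ModelDiag I} {MJ : ModelDiag J} {ME : ModelDiag E}
    (α : MDHom MI MJ) (β : MDHom MJ ME) : MDHom MI ME where
  func := α.func ⋙ β.func
  map_W _ hf := β.map_W _ (α.map_W _ hf)
  map_C _ hf := β.map_C _ (α.map_C _ hf)
  map_F _ hf := β.map_F _ (α.map_F _ hf)

/-- The identity morphism of model diagrams. -/
def MDHom.id (MI : ModelDiag I) : MDHom MI MI where
  func := Functor.id I
  map_W _ hf := hf
  map_C _ hf := hf
  map_F _ hf := hf

/-- A morphism of doubly-pointed model diagrams: a morphism of model diagrams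
preserving the two chosen objects. -/
structure PtdMDHom (MI : ModelDiag I) (sI tI : I) (ME : ModelDiag E) (sE tE : E)
    extends MDHom MI ME where
  hs : func.obj sI = sE
  ht : func.obj tI = tE

/-- Composition of morphisms of doubly-pointed model diagrams. -/
def PtdMDHom.comp {MI : ModelDiag I} {sI tI : I} {MJ : ModelDiag J} {sJ tJ : J}
    {ME : ModelDiag E} {sE tE : E} (α : PtdMDHom MI sI tI MJ sJ tJ)
    (β : PtdMDHom MJ sJ tJ ME sE tE) : PtdMDHom MI sI tI ME sE tE where
  toMDHom := α.toMDHom.comp β.toMDHom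
  hs := by
    show β.func.obj (α.func.obj sI) = sE
    rw [α.hs, β.hs]
  ht := by
    show β.func.obj (α.func.obj tI) = tE
    rw [α.ht, β.ht]

/-- The identity as a morphism of doubly-pointed model diagrams. -/
def PtdMDHom.ptdId (MI : ModelDiag I) (sI tI : I) : PtdMDHom MI sI tI MI sI tI where
  toMDHom := MDHom.id MI
  hs := rfl
  ht := rfl

/-- The category `Fun_{**}(I,E)^W`: objects are the morphisms of doubly-pointed model
diagrams `I → E`; morphisms are the natural transformations all of whose components lie
in `W_E` and whose components at `s` and `t` are identities. -/
def FunPt (MI : ModelDiag I) (sI tI : I) (ME : ModelDiag E) (sE tE : E) : Type (max u v) :=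
  PtdMDHom MI sI tI ME sE tE

instance {MI : ModelDiag I} {sI tI : I} {ME : ModelDiag E} {sE tE : E} :
    Category.{max u v} (FunPt MI sI tI ME sE tE) where
  Hom X Y := { η : X.func ⟶ Y.func // (∀ i : I, ME.W (η.app i)) ∧
    η.app sI = eqToHom (X.hs.trans Y.hs.symm) ∧
    η.app tI = eqToHom (X.ht.trans Y.ht.symm) }
  id X := ⟨𝟙 X.func, fun _ => ME.W_id _, by simp, by simp⟩
  comp {X Y Z} η θ := ⟨η.1 ≫ θ.1, fun i => ME.W_comp _ _ (η.2.1 i) (θ.2.1 i),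
    by rw [NatTrans.comp_app, η.2.2.1, θ.2.2.1, eqToHom_trans],
    by rw [NatTrans.comp_app, η.2.2.2, θ.2.2.2, eqToHom_trans]⟩
  id_comp _ := by apply Subtype.ext; simp
  comp_id _ := by apply Subtype.ext; simp
  assoc _ _ _ := by apply Subtype.ext; simp

/-- Restriction `Fun_{**}(J,E)^W ⥤ Fun_{**}(I,E)^W` along a morphism of doubly-pointed
model diagrams `φ : I → J`. -/
def restrict {MI : ModelDiag I} {sI tI : I} {MJ : ModelDiag J} {sJ tJ : J}
    (φ : PtdMDHom MI sI tI MJ sJ tJ) (ME : ModelDiag E) (sE tE : E) :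
    FunPt MJ sJ tJ ME sE tE ⥤ FunPt MI sI tI ME sE tE where
  obj X :=
    { func := φ.func ⋙ X.func
      map_W := fun f hf => X.map_W _ (φ.map_W f hf)
      map_C := fun f hf => X.map_C _ (φ.map_C f hf)
      map_F := fun f hf => X.map_F _ (φ.map_F f hf)
      hs := by show X.func.obj (φ.func.obj sI) = sE; rw [φ.hs, X.hs]
      ht := by show X.func.obj (φ.func.obj tI) = tE; rw [φ.ht, X.ht] }
  map {X Y} η := ⟨CategoryTheory.Functor.whiskerLeft φ.func η.1, fun i => η.2.1 _,
    by
      show η.1.app (φ.func.obj sI) = _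
      rw [natTrans_app_congr η.1 φ.hs, η.2.2.1, eqToHom_trans, eqToHom_trans],
    by
      show η.1.app (φ.func.obj tI) = _
      rw [natTrans_app_congr η.1 φ.ht, η.2.2.2, eqToHom_trans, eqToHom_trans]⟩
  map_id _ := rfl
  map_comp _ _ := rfl

end ModelDiagrams

/-- The collage of a Quillen adjunction as a model diagram: weak equivalences,
cofibrations and fibrations are those of the two fibers; bridge morphisms lie in none of
the three classes. -/
def collageDiag {C : Type u} {D : Type u} [Category.{v} C] [Category.{v} D]
    {MC : ModelStructure C} {MD : ModelStructure D}
    (Q : QuillenAdjunction MC MD) (PC : C → Prop) (PD : D → Prop) :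
    ModelDiag (Collage Q.G PC PD) where
  W := collW Q.G PC PD MC.W MD.W
  C := collW Q.G PC PD MC.Cof MD.Cof
  F := collW Q.G PC PD MC.Fib MD.Fib
  W_id X := by
    rcases X with x|y
    · exact MC.W_id x.1
    · exact MD.W_id y.1
  C_id X := by
    rcases X with x|y
    · exact MC.Cof_id x.1
    · exact MD.Cof_id y.1
  F_id X := by
    rcases X with x|y
    · exact MC.Fib_id x.1
    · exact MD.Fib_id y.1
  W_comp {X Y Z} f g hf hg := by
    rcases X with x|y <;> rcases Y with x'|y' <;> rcases Z with x''|y'' <;>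
      first
        | exact f.elim | exact g.elim | exact hf.elim | exact hg.elim
        | exact MC.W_comp f g hf hg
        | exact MD.W_comp f g hf hg
  C_comp {X Y Z} f g hf hg := by
    rcases X with x|y <;> rcases Y with x'|y' <;> rcases Z with x''|y'' <;>
      first
        | exact f.elim | exact g.elim | exact hf.elim | exact hg.elim
        | exact MC.Cof_comp f g hf hg
        | exact MD.Cof_comp f g hf hg
  F_comp {X Y Z} f g hf hg := by
    rcases X with x|y <;> rcases Y with x'|y' <;> rcases Z with x''|y'' <;>
      first
        | exact f.elim | exact g.elim | exact hf.elim | exact hg.elim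
        | exact MC.Fib_comp f g hf hg
        | exact MD.Fib_comp f g hf hg
  W_of_precomp {X Y Z} f g hf hfg := by
    rcases X with x|y <;> rcases Y with x'|y' <;> rcases Z with x''|y'' <;>
      first
        | exact f.elim | exact g.elim | exact hf.elim | exact hfg.elim
        | exact MC.W_of_precomp f g hf hfg
        | exact MD.W_of_precomp f g hf hfg
  W_of_postcomp {X Y Z} f g hg hfg := by
    rcases X with x|y <;> rcases Y with x'|y' <;> rcases Z with x''|y'' <;>
      first
        | exact f.elim | exact g.elim | exact hg.elim | exact hfg.elim
        | exact MC.W_of_postcomp f g hg hfg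
        | exact MD.W_of_postcomp f g hg hfg

section Decorations

/-- A commutative square in a category. -/
structure SquareIn (I : Type u) [Category.{v} I] where
  {X : I} {Y : I} {Z : I} {W : I}
  t : X ⟶ Y
  l : X ⟶ Z
  r : Y ⟶ W
  b : Z ⟶ W
  comm : t ≫ r = l ≫ b

/-- The image of a commutative square under a functor. -/
def SquareIn.fmap {I : Type u} {J : Type u} [Category.{v} I] [Category.{v} J]
    (F : I ⥤ J) (sq : SquareIn I) : SquareIn J where
  t := F.map sq.t
  l := F.map sq.l
  r := F.map sq.r
  b := F.map sq.b
  comm := by rw [← F.map_comp, ← F.map_comp, sq.comm]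

/-- A decoration on a (doubly-pointed) model diagram: collections of objects marked
`cofibrant` or `fibrant`, and collections of commutative squares marked as pushouts or
pullbacks. -/
structure Decor (I : Type u) [Category.{v} I] where
  cofObj : I → Prop
  fibObj : I → Prop
  po : SquareIn I → Prop
  pb : SquareIn I → Prop

/-- An object of a model diagram is cofibrant if the map to it from an initial object is
a cofibration. -/
def CofibrantObj {E : Type u} [Category.{v} E] (ME : ModelDiag E) (x : E) : Prop :=
  ∃ (i : E) (hi : IsInitial i), ME.C (hi.to x)

/-- An object of a model diagram is fibrant if the map from it to a terminal object is a
fibration. -/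
def FibrantObj {E : Type u} [Category.{v} E] (ME : ModelDiag E) (x : E) : Prop :=
  ∃ (p : E) (hp : IsTerminal p), ME.F (hp.from x)

/-- A functor into a model diagram `E` satisfies a decoration if it carries objects
marked `cofibrant` (resp. `fibrant`) to cofibrant (resp. fibrant) objects of `E`, and
marked squares to pushout (resp. pullback) squares in `E`. -/
def SatDec {I : Type u} {E : Type u} [Category.{v} I] [Category.{v} E]
    (dec : Decor I) (ME : ModelDiag E) (Xf : I ⥤ E) : Prop :=
  (∀ o, dec.cofObj o → CofibrantObj ME (Xf.obj o)) ∧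
  (∀ o, dec.fibObj o → FibrantObj ME (Xf.obj o)) ∧
  (∀ sq, dec.po sq → IsPushout (Xf.map sq.t) (Xf.map sq.l) (Xf.map sq.r) (Xf.map sq.b)) ∧
  (∀ sq, dec.pb sq → IsPullback (Xf.map sq.t) (Xf.map sq.l) (Xf.map sq.r) (Xf.map sq.b))

/-- A morphism of decorated doubly-pointed model diagrams is decoration-respecting if
restriction along it is well defined, i.e. carries decoration-satisfying morphisms of
model diagrams to decoration-satisfying ones. -/
def DecRespects {I : Type u} {J : Type u} [Category.{v} I] [Category.{v} J]
    {MI : ModelDiag I} {sI tI : I} {MJ : ModelDiag J} {sJ tJ : J}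
    (decI : Decor I) (decJ : Decor J) (α : PtdMDHom MI sI tI MJ sJ tJ) : Prop :=
  ∀ (E : Type u) [Category.{v} E] (ME : ModelDiag E) (Xf : J ⥤ E),
    SatDec decJ ME Xf → SatDec decI ME (α.func ⋙ Xf)

/-- The category `Fun*_{**}(I,E)^W`: the full subcategory of `Fun_{**}(I,E)^W` on the
decoration-satisfying morphisms of doubly-pointed model diagrams. -/
abbrev FunStar {I : Type u} {E : Type u} [Category.{v} I] [Category.{v} E]
    (decI : Decor I) (MI : ModelDiag I) (sI tI : I) (ME : ModelDiag E) (sE tE : E) :=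
  ObjectProperty.FullSubcategory (fun X : FunPt MI sI tI ME sE tE => SatDec decI ME X.func)

/-- Restriction `Fun*_{**}(J,E)^W ⥤ Fun*_{**}(I,E)^W` along a decoration-respecting
morphism of decorated doubly-pointed model diagrams. -/
def restrictStar {I : Type u} {J : Type u} {E : Type u}
    [Category.{v} I] [Category.{v} J] [Category.{v} E]
    {MI : ModelDiag I} {sI tI : I} {MJ : ModelDiag J} {sJ tJ : J}
    (decI : Decor I) (decJ : Decor J)
    (α : PtdMDHom MI sI tI MJ sJ tJ) (hα : DecRespects decI decJ α)
    (ME : ModelDiag E) (sE tE : E) :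
    FunStar decJ MJ sJ tJ ME sE tE ⥤ FunStar decI MI sI tI ME sE tE where
  obj X := ⟨(restrict α ME sE tE).obj X.obj, hα E ME X.obj.func X.property⟩
  map η := ObjectProperty.homMk ((restrict α ME sE tE).map η.hom)
  map_id _ := rfl
  map_comp _ _ := rfl

end Decorations

section WeakEquivalences

open MonoidalCategory CartesianMonoidalCategory Simplicial SSet

lemma SHomotopy.of_tensor {X Y : SSet.{w}} {f g : X ⟶ Y} (H : X ⊗ Δ[1] ⟶ Y)
    (h₀ : SSet.ι₀ ≫ H = f) (h₁ : SSet.ι₁ ≫ H = g) : SHomotopy f g := by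
  refine ⟨CartesianMonoidalCategory.lift prod.fst prod.snd ≫ H, ?_, ?_⟩
  · rw [← h₀, ← Category.assoc]
    congr 1
    apply CartesianMonoidalCategory.hom_ext
    · rw [Category.assoc, lift_fst, Limits.prod.lift_fst, SSet.ι₀_fst]
    · simp only [Category.assoc, lift_snd, Limits.prod.lift_snd, SSet.ι₀_snd]
      rfl
  · rw [← h₁, ← Category.assoc]
    congr 1
    apply CartesianMonoidalCategory.hom_ext
    · rw [Category.assoc, lift_fst, Limits.prod.lift_fst, SSet.ι₁_fst]
    · simp only [Category.assoc, lift_snd, Limits.prod.lift_snd, SSet.ι₁_snd]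
      rfl

lemma SHomotopy.exists_tensor {X Y : SSet.{w}} {f g : X ⟶ Y} (h : SHomotopy f g) :
    ∃ H : X ⊗ Δ[1] ⟶ Y, SSet.ι₀ ≫ H = f ∧ SSet.ι₁ ≫ H = g := by
  obtain ⟨H, h₀, h₁⟩ := h
  refine ⟨prod.lift (fst _ _) (snd _ _) ≫ H, ?_, ?_⟩
  · rw [← h₀, ← Category.assoc]
    congr 1
    apply Limits.prod.hom_ext
    · rw [Category.assoc, Limits.prod.lift_fst, Limits.prod.lift_fst, SSet.ι₀_fst]
    · simp only [Category.assoc, Limits.prod.lift_snd, SSet.ι₀_snd]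
      rfl
  · rw [← h₁, ← Category.assoc]
    congr 1
    apply Limits.prod.hom_ext
    · rw [Category.assoc, Limits.prod.lift_fst, Limits.prod.lift_fst, SSet.ι₁_fst]
    · simp only [Category.assoc, Limits.prod.lift_snd, SSet.ι₁_snd]
      rfl

lemma SHomotopy.comp_right {X Y Z : SSet.{w}} {f g : X ⟶ Y} (h : SHomotopy f g) (k : Y ⟶ Z) :
    SHomotopy (f ≫ k) (g ≫ k) := by
  obtain ⟨H, h₀, h₁⟩ := h.exists_tensor
  exact .of_tensor (H ≫ k) (by rw [← Category.assoc, h₀]) (by rw [← Category.assoc, h₁])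

lemma SHomotopy.comp_left {X Y Z : SSet.{w}} {f g : Y ⟶ Z} (h : SHomotopy f g) (k : X ⟶ Y) :
    SHomotopy (k ≫ f) (k ≫ g) := by
  obtain ⟨H, h₀, h₁⟩ := h.exists_tensor
  exact .of_tensor (k ▷ _ ≫ H) (by rw [SSet.ι₀_comp_assoc, h₀]) (by rw [SSet.ι₁_comp_assoc, h₁])

lemma Htpy.refl {X Y : SSet.{w}} (f : X ⟶ Y) : Htpy f f := Relation.EqvGen.refl _

lemma Htpy.symm {X Y : SSet.{w}} {f g : X ⟶ Y} (h : Htpy f g) : Htpy g f :=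
  Relation.EqvGen.symm _ _ h

lemma Htpy.trans {X Y : SSet.{w}} {f g k : X ⟶ Y} (h : Htpy f g) (h' : Htpy g k) : Htpy f k :=
  Relation.EqvGen.trans _ _ _ h h'

lemma SHomotopy.htpy {X Y : SSet.{w}} {f g : X ⟶ Y} (h : SHomotopy f g) : Htpy f g :=
  Relation.EqvGen.rel _ _ h

lemma Htpy.comp_right {X Y Z : SSet.{w}} {f g : X ⟶ Y} (h : Htpy f g) (k : Y ⟶ Z) :
    Htpy (f ≫ k) (g ≫ k) := by
  induction h with
  | rel _ _ h => exact (h.comp_right k).htpy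
  | refl => exact .refl _
  | symm _ _ _ ih => exact ih.symm
  | trans _ _ _ _ _ ih ih' => exact ih.trans ih'

lemma Htpy.comp_left {X Y Z : SSet.{w}} {f g : Y ⟶ Z} (h : Htpy f g) (k : X ⟶ Y) :
    Htpy (k ≫ f) (k ≫ g) := by
  induction h with
  | rel _ _ h => exact (h.comp_left k).htpy
  | refl => exact .refl _
  | symm _ _ _ ih => exact ih.symm
  | trans _ _ _ _ _ ih ih' => exact ih.trans ih'

lemma IsWeakHomotopyEquiv.of_htpy {X Y : SSet.{w}} {f g : X ⟶ Y} (h : Htpy f g)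
    (hf : IsWeakHomotopyEquiv f) : IsWeakHomotopyEquiv g := by
  intro K hK
  obtain ⟨h₁, h₂⟩ := hf K hK
  refine ⟨fun k ↦ ?_, fun k k' hk ↦ h₂ _ _ ?_⟩
  · obtain ⟨l, hl⟩ := h₁ k
    exact ⟨l, (h.symm.comp_right l).trans hl⟩
  · exact (h.comp_right k).trans (hk.trans (h.symm.comp_right k'))

lemma IsWeakHomotopyEquiv.id (X : SSet.{w}) : IsWeakHomotopyEquiv (𝟙 X) := by
  intro K hK
  exact ⟨fun g ↦ ⟨g, by simpa using Htpy.refl g⟩, fun h h' hh ↦ by simpa using hh⟩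

lemma IsWeakHomotopyEquiv.comp {X Y Z : SSet.{w}} {f : X ⟶ Y} {g : Y ⟶ Z}
    (hf : IsWeakHomotopyEquiv f) (hg : IsWeakHomotopyEquiv g) :
    IsWeakHomotopyEquiv (f ≫ g) := by
  intro K hK
  obtain ⟨f₁, f₂⟩ := hf K hK
  obtain ⟨g₁, g₂⟩ := hg K hK
  refine ⟨fun k ↦ ?_, fun k k' hk ↦ g₂ _ _ (f₂ _ _ (by simpa using hk))⟩
  obtain ⟨l, hl⟩ := f₁ k
  obtain ⟨m, hm⟩ := g₁ l
  exact ⟨m, by simpa using (hm.comp_left f).trans hl⟩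

/-- If both composites `f ≫ g` and `g ≫ h` are weak equivalences, then so is `g`. -/
lemma IsWeakHomotopyEquiv.of_two_of_six {X Y Z T : SSet.{w}} {f : X ⟶ Y} {g : Y ⟶ Z} {h : Z ⟶ T}
    (hfg : IsWeakHomotopyEquiv (f ≫ g)) (hgh : IsWeakHomotopyEquiv (g ≫ h)) :
    IsWeakHomotopyEquiv g := by
  intro K hK
  obtain ⟨a₁, a₂⟩ := hfg K hK
  obtain ⟨b₁, b₂⟩ := hgh K hK
  refine ⟨fun k ↦ ?_, fun k k' hk ↦ a₂ _ _ (by simpa using hk.comp_left f)⟩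
  obtain ⟨l, hl⟩ := b₁ k
  exact ⟨h ≫ l, by simpa using hl⟩

/-- A map with a two-sided homotopy inverse is a weak equivalence. -/
lemma IsWeakHomotopyEquiv.of_homotopyInverse {X Y : SSet.{w}} {f : X ⟶ Y} {g : Y ⟶ X}
    (h₁ : Htpy (f ≫ g) (𝟙 X)) (h₂ : Htpy (g ≫ f) (𝟙 Y)) : IsWeakHomotopyEquiv f := by
  intro K hK
  refine ⟨fun k ↦ ⟨g ≫ k, by simpa using h₁.comp_right k⟩, fun k k' hk ↦ ?_⟩
  have h := hk.comp_left g
  simp only [← Category.assoc] at h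
  have e₁ := h₂.comp_right k
  have e₂ := h₂.comp_right k'
  rw [Category.id_comp] at e₁ e₂
  exact e₁.symm.trans (h.trans e₂)

lemma KanComplex.fibration {K : SSet.{w}} (hK : Paper.KanComplex K) :
    modelCategoryQuillen.J.rlp (terminal.from K) := by
  intro A B i hi
  simp only [modelCategoryQuillen.J, MorphismProperty.iSup_iff] at hi
  obtain ⟨n, ⟨k⟩⟩ := hi
  constructor
  intro f g sq
  obtain ⟨σ, hσ⟩ := hK.hornFilling f
  exact ⟨⟨⟨σ, hσ.symm, terminal.hom_ext _ _⟩⟩⟩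

lemma exists_extension_of_anodyne {A X K : SSet.{w}} {i : A ⟶ X} (hi : anodyneExtensions i)
    (hK : Paper.KanComplex K) (f : A ⟶ K) : ∃ g : X ⟶ K, i ≫ g = f := by
  have := hi (terminal.from K) hK.fibration
  have sq : CommSq f i (terminal.from K) (terminal.from X) := ⟨terminal.hom_ext _ _⟩
  exact ⟨sq.lift, sq.fac_left⟩

/-- Construct a map of simplicial sets from functions compatible with the structure maps. -/
def mkHom {X Y : SSet.{w}} (f : ∀ m, X.obj m → Y.obj m)
    (hf : ∀ ⦃m m'⦄ (θ : m ⟶ m') (x : X.obj m), f m' (X.map θ x) = Y.map θ (f m x)) : X ⟶ Y where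
  app m := ↾(f m)
  naturality _ _ θ := by ext x; exact hf θ x

lemma sset_hom_ext {X Y : SSet.{w}} {f g : X ⟶ Y} (h : ∀ m (x : X.obj m), f.app m x = g.app m x) :
    f = g := by
  ext m x; exact h m x

lemma sset_congr_app {X Y : SSet.{w}} {f g : X ⟶ Y} (h : f = g) (m) (x : X.obj m) :
    f.app m x = g.app m x := by rw [h]

open Classical in
/-- The map `X ⊗ T ⟶ K`, for `T` a subcomplex of `Δ[1]` on whose simplices the first vertex
is locally constant, given by a pair of maps `X ⟶ K`. -/
noncomputable def pairMap {X K : SSet.{w}} (T : Δ[1].Subcomplex) (hT : T ≤ ∂Δ[1])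
    (h h' : X ⟶ K) : X ⊗ (T : SSet.{w}) ⟶ K :=
  mkHom (fun m z ↦ if stdSimplex.asOrderHom z.2.1 0 = 0 then h.app _ z.1 else h'.app _ z.1) (by
    intro m m' θ z
    have hc : ∀ j, stdSimplex.asOrderHom z.2.1 j = stdSimplex.asOrderHom z.2.1 0 := by
      intro j
      by_contra hj
      apply hT _ z.2.2
      intro b
      by_cases hb : b = stdSimplex.asOrderHom z.2.1 0
      · exact ⟨0, hb.symm⟩
      · exact ⟨j, by lia⟩
    have e : stdSimplex.asOrderHom ((X ⊗ (T : SSet.{w})).map θ z).2.1 0 =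
        stdSimplex.asOrderHom z.2.1 0 := hc _
    simp only [e]
    split_ifs
    · exact NatTrans.naturality_apply h θ z.1
    · exact NatTrans.naturality_apply h' θ z.1)

lemma exists_pushoutProduct_lift {A X P Q : SSet.{w}} (i : A ⟶ X) [Mono i] {T : Δ[1].Subcomplex}
    (h : anodyneExtensions i ∨ anodyneExtensions T.ι) {p : P ⟶ Q}
    (hp : modelCategoryQuillen.J.rlp p) (f : X ⊗ (T : SSet.{w}) ⟶ P) (g : A ⊗ Δ[1] ⟶ P)
    (k : X ⊗ Δ[1] ⟶ Q) (hfg : i ▷ _ ≫ f = A ◁ T.ι ≫ g) (hf : f ≫ p = X ◁ T.ι ≫ k)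
    (hg : g ≫ p = i ▷ _ ≫ k) :
    ∃ l : X ⊗ Δ[1] ⟶ P, X ◁ T.ι ≫ l = f ∧ i ▷ _ ≫ l = g ∧ l ≫ p = k := by
  let sq := Functor.PushoutObjObj.ofHasPushout (curriedTensor SSet.{w}) i T.ι
  have hsq : anodyneExtensions sq.ι := by
    obtain h | h := h
    · exact anodyneExtensions_pushoutObjObjι' sq h
    · exact anodyneExtensions_pushoutObjObjι sq h
  have := hsq p hp
  have h₁ : sq.inl ≫ sq.isPushout.desc f g hfg = f := sq.isPushout.inl_desc _ _ _
  have h₂ : sq.inr ≫ sq.isPushout.desc f g hfg = g := sq.isPushout.inr_desc _ _ _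
  have comm : CommSq (sq.isPushout.desc f g hfg) sq.ι p k := ⟨by
    apply sq.isPushout.hom_ext
    · rw [reassoc_of% h₁, sq.inl_ι_assoc, hf]; rfl
    · rw [reassoc_of% h₂, sq.inr_ι_assoc, hg]; rfl⟩
  refine ⟨comm.lift, ?_, ?_, comm.fac_right⟩
  · exact (sq.inl_ι_assoc _).symm.trans ((congrArg (sq.inl ≫ ·) comm.fac_left).trans h₁)
  · exact (sq.inr_ι_assoc _).symm.trans ((congrArg (sq.inr ≫ ·) comm.fac_left).trans h₂)

lemma stdSimplex_ext {n : ℕ} {m} {s t : (Δ[n] : SSet.{w}).obj m}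
    (h : ∀ j, stdSimplex.asOrderHom s j = stdSimplex.asOrderHom t j) : s = t := by
  apply stdSimplex.objEquiv.injective
  apply SimplexCategory.Hom.ext
  exact OrderHom.ext _ _ (funext h)

lemma ι₀_app_eq {X : SSet.{w}} {m} (x : X.obj m) (t : (Δ[1] : SSet.{w}).obj m)
    (h : ∀ j, stdSimplex.asOrderHom t j = 0) : (SSet.ι₀ (X := X)).app m x = (x, t) :=
  Prod.ext rfl (stdSimplex_ext fun j ↦ (h j).symm)

lemma ι₁_app_eq {X : SSet.{w}} {m} (x : X.obj m) (t : (Δ[1] : SSet.{w}).obj m)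
    (h : ∀ j, stdSimplex.asOrderHom t j = 1) : (SSet.ι₁ (X := X)).app m x = (x, t) :=
  Prod.ext rfl (stdSimplex_ext fun j ↦ (h j).symm)

lemma boundary_one_const {m} {t : (Δ[1] : SSet.{w}).obj m} (ht : t ∈ ∂Δ[1].obj m) :
    (∀ j, stdSimplex.asOrderHom t j = 0) ∨ (∀ j, stdSimplex.asOrderHom t j = 1) := by
  by_contra! h
  obtain ⟨⟨i, hi⟩, ⟨j, hj⟩⟩ := h
  apply ht
  intro b
  by_cases hb : b = stdSimplex.asOrderHom t i
  · exact ⟨i, hb.symm⟩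
  · exact ⟨j, by lia⟩

lemma pairMap_app_zero {X K : SSet.{w}} (T : Δ[1].Subcomplex) (hT : T ≤ ∂Δ[1])
    (h h' : X ⟶ K) {m} (x : X.obj m) (t : T.obj m)
    (ht : ∀ j, stdSimplex.asOrderHom t.1 j = 0) :
    (pairMap T hT h h').app m (x, t) = h.app m x :=
  if_pos (ht 0)

lemma pairMap_app_one {X K : SSet.{w}} (T : Δ[1].Subcomplex) (hT : T ≤ ∂Δ[1])
    (h h' : X ⟶ K) {m} (x : X.obj m) (t : T.obj m)
    (ht : ∀ j, stdSimplex.asOrderHom t.1 j = 1) :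
    (pairMap T hT h h').app m (x, t) = h'.app m x :=
  if_neg (by rw [ht 0]; decide)

/-- The end `e` of a map out of `X ⊗ T`. -/
lemma pairMap_ext {X K : SSet.{w}} (T : Δ[1].Subcomplex) (hT : T ≤ ∂Δ[1])
    {f g : X ⊗ (T : SSet.{w}) ⟶ K}
    (h₀ : ∀ m (x : X.obj m) (t : T.obj m), (∀ j, stdSimplex.asOrderHom t.1 j = 0) →
      f.app m (x, t) = g.app m (x, t))
    (h₁ : ∀ m (x : X.obj m) (t : T.obj m), (∀ j, stdSimplex.asOrderHom t.1 j = 1) →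
      f.app m (x, t) = g.app m (x, t)) : f = g := by
  apply sset_hom_ext
  rintro m ⟨x, t⟩
  obtain h | h := boundary_one_const (hT _ t.2)
  · exact h₀ m x t h
  · exact h₁ m x t h

lemma SHomotopy.of_anodyne {A X K : SSet.{w}} {i : A ⟶ X} [Mono i] (hi : anodyneExtensions i)
    (hK : Paper.KanComplex K) {f g : X ⟶ K} (h : SHomotopy (i ≫ f) (i ≫ g)) :
    SHomotopy f g := by
  obtain ⟨H, h₀, h₁⟩ := h.exists_tensor
  obtain ⟨G, hG, -, -⟩ := exists_pushoutProduct_lift i (.inl hi) hK.fibration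
    (pairMap ∂Δ[1] le_rfl f g) H (terminal.from _) (by
      apply pairMap_ext _ le_rfl
      · intro m x t ht
        have := sset_congr_app h₀ m x
        refine Eq.trans ?_ (this.symm.trans ?_)
        · exact pairMap_app_zero _ le_rfl _ _ _ _ ht
        · exact congrArg (H.app m) (ι₀_app_eq _ _ ht)
      · intro m x t ht
        have := sset_congr_app h₁ m x
        refine Eq.trans ?_ (this.symm.trans ?_)
        · exact pairMap_app_one _ le_rfl _ _ _ _ ht
        · exact congrArg (H.app m) (ι₁_app_eq _ _ ht)) (terminal.hom_ext _ _)
        (terminal.hom_ext _ _)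
  refine .of_tensor G ?_ ?_
  · apply sset_hom_ext
    intro m x
    have hm : ((SSet.ι₀ (X := X)).app m x).2 ∈ ∂Δ[1].obj m := fun hs ↦ by
      obtain ⟨a, ha⟩ := hs 1
      exact absurd ha (show (0 : Fin 2) ≠ 1 by decide)
    exact (sset_congr_app hG m (x, ⟨_, hm⟩)).trans
      (pairMap_app_zero _ le_rfl _ _ _ _ fun _ ↦ rfl)
  · apply sset_hom_ext
    intro m x
    have hm : ((SSet.ι₁ (X := X)).app m x).2 ∈ ∂Δ[1].obj m := fun hs ↦ by
      obtain ⟨a, ha⟩ := hs 0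
      exact absurd ha (show (1 : Fin 2) ≠ 0 by decide)
    exact (sset_congr_app hG m (x, ⟨_, hm⟩)).trans
      (pairMap_app_one _ le_rfl _ _ _ _ fun _ ↦ rfl)

lemma IsWeakHomotopyEquiv.of_anodyne {A X : SSet.{w}} {i : A ⟶ X} [Mono i]
    (hi : anodyneExtensions i) : IsWeakHomotopyEquiv i := by
  intro K hK
  refine ⟨fun g ↦ ?_, fun h h' hh ↦ ?_⟩
  · obtain ⟨h, hh⟩ := exists_extension_of_anodyne hi hK g
    exact ⟨h, by rw [hh]; exact .refl _⟩
  · suffices ∀ a b : A ⟶ K, Htpy a b → ∀ h h' : X ⟶ K, i ≫ h = a → i ≫ h' = b → Htpy h h' from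
      this _ _ hh _ _ rfl rfl
    intro a b hab
    induction hab with
    | rel _ _ hs => rintro h h' rfl rfl; exact (SHomotopy.of_anodyne hi hK hs).htpy
    | refl a =>
      rintro h h' h₁ h₂
      refine (SHomotopy.of_anodyne hi hK ?_).htpy
      rw [h₁, h₂, ← h₁]
      exact .of_tensor (CartesianMonoidalCategory.fst _ _ ≫ i ≫ h) rfl rfl
    | symm _ _ _ ih => exact fun h h' e e' ↦ (ih h' h e' e).symm
    | trans a b c _ _ ih ih' =>
      intro h h' e e'
      obtain ⟨k, hk⟩ := exists_extension_of_anodyne hi hK b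
      exact (ih h k e hk).trans (ih' k h' hk e')

/-- Extending lifts along a homotopy relative to one end of the cylinder. -/
lemma exists_homotopy_lift₀ {A X P Q : SSet.{w}} (i : A ⟶ X) [Mono i] {p : P ⟶ Q}
    (hp : modelCategoryQuillen.J.rlp p) (f : X ⟶ P) (g : A ⊗ Δ[1] ⟶ P)
    (k : X ⊗ Δ[1] ⟶ Q) (hfg : i ≫ f = SSet.ι₀ ≫ g) (hf : f ≫ p = SSet.ι₀ ≫ k)
    (hg : g ≫ p = i ▷ _ ≫ k) :
    ∃ l : X ⊗ Δ[1] ⟶ P, SSet.ι₀ ≫ l = f ∧ i ▷ _ ≫ l = g ∧ l ≫ p = k := by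
  have hT : (Λ[1, 0] : Δ[1].Subcomplex) ≤ ∂Δ[1] := fun m t ht hs ↦ ht (by
    simp [Set.range_eq_univ.2 hs])
  have hT0 : ∀ m (t : (Λ[1, 0] : (Δ[1] : SSet.{w}).Subcomplex).obj m) (j),
      stdSimplex.asOrderHom t.1 j = 0 := by
    intro m t j
    by_contra hj
    refine t.2 (Set.eq_univ_of_forall fun b ↦ ?_)
    by_cases hb : b = 0
    · exact .inr hb
    · exact .inl ⟨j, by lia⟩
  obtain ⟨l, hl, h₁, h₂⟩ := exists_pushoutProduct_lift i (.inr (anodyneExtensions.horn_ι 0)) hp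
    (CartesianMonoidalCategory.fst _ _ ≫ f) g k (by
      apply pairMap_ext _ hT
      · intro m x t ht
        refine (sset_congr_app hfg m x).trans ?_
        exact congrArg (g.app m) (ι₀_app_eq _ _ ht)
      · intro m x t ht
        exact absurd ((ht 0).symm.trans (hT0 _ t 0)) (by decide)) (by
      apply pairMap_ext _ hT
      · intro m x t ht
        refine (sset_congr_app hf m x).trans ?_
        exact congrArg (k.app m) (ι₀_app_eq _ _ ht)
      · intro m x t ht
        exact absurd ((ht 0).symm.trans (hT0 _ t 0)) (by decide)) hg
  refine ⟨l, ?_, h₁, h₂⟩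
  apply sset_hom_ext
  intro m x
  have hm : ((SSet.ι₀ (X := X)).app m x).2 ∈ (Λ[1, 0] : (Δ[1] : SSet.{w}).Subcomplex).obj m := by
    intro hs
    obtain ⟨a, ha⟩ | hs := hs.ge (Set.mem_univ 1)
    · exact absurd ha (show (0 : Fin 2) ≠ 1 by decide)
    · exact absurd hs (show (1 : Fin 2) ≠ 0 by decide)
  exact sset_congr_app hl m (x, ⟨_, hm⟩)

lemma exists_homotopy_lift₁ {A X P Q : SSet.{w}} (i : A ⟶ X) [Mono i] {p : P ⟶ Q}
    (hp : modelCategoryQuillen.J.rlp p) (f : X ⟶ P) (g : A ⊗ Δ[1] ⟶ P)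
    (k : X ⊗ Δ[1] ⟶ Q) (hfg : i ≫ f = SSet.ι₁ ≫ g) (hf : f ≫ p = SSet.ι₁ ≫ k)
    (hg : g ≫ p = i ▷ _ ≫ k) :
    ∃ l : X ⊗ Δ[1] ⟶ P, SSet.ι₁ ≫ l = f ∧ i ▷ _ ≫ l = g ∧ l ≫ p = k := by
  have hT : (Λ[1, 1] : Δ[1].Subcomplex) ≤ ∂Δ[1] := fun m t ht hs ↦ ht (by
    simp [Set.range_eq_univ.2 hs])
  have hT0 : ∀ m (t : (Λ[1, 1] : (Δ[1] : SSet.{w}).Subcomplex).obj m) (j),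
      stdSimplex.asOrderHom t.1 j = 1 := by
    intro m t j
    by_contra hj
    refine t.2 (Set.eq_univ_of_forall fun b ↦ ?_)
    by_cases hb : b = 1
    · exact .inr hb
    · exact .inl ⟨j, by lia⟩
  obtain ⟨l, hl, h₁, h₂⟩ := exists_pushoutProduct_lift i (.inr (anodyneExtensions.horn_ι 1)) hp
    (CartesianMonoidalCategory.fst _ _ ≫ f) g k (by
      apply pairMap_ext _ hT
      · intro m x t ht
        exact absurd ((ht 0).symm.trans (hT0 _ t 0)) (by decide)
      · intro m x t ht
        refine (sset_congr_app hfg m x).trans ?_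
        exact congrArg (g.app m) (ι₁_app_eq _ _ ht)) (by
      apply pairMap_ext _ hT
      · intro m x t ht
        exact absurd ((ht 0).symm.trans (hT0 _ t 0)) (by decide)
      · intro m x t ht
        refine (sset_congr_app hf m x).trans ?_
        exact congrArg (k.app m) (ι₁_app_eq _ _ ht)) hg
  refine ⟨l, ?_, h₁, h₂⟩
  apply sset_hom_ext
  intro m x
  have hm : ((SSet.ι₁ (X := X)).app m x).2 ∈ (Λ[1, 1] : (Δ[1] : SSet.{w}).Subcomplex).obj m := by
    intro hs
    obtain ⟨a, ha⟩ | hs := hs.ge (Set.mem_univ 0)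
    · exact absurd ha (show (1 : Fin 2) ≠ 0 by decide)
    · exact absurd hs (show (0 : Fin 2) ≠ 1 by decide)
  exact sset_congr_app hl m (x, ⟨_, hm⟩)

end WeakEquivalences

section NerveHomotopy

open MonoidalCategory CartesianMonoidalCategory Simplicial SSet

variable {C D B : Type w} [SmallCategory C] [SmallCategory D] [SmallCategory B]

@[simp]
lemma nerveMap_app (F : C ⥤ D) {m} (X : (nerve C).obj m) :
    (nerveMap F).app m X = (show ComposableArrows C m.unop.len from X) ⋙ F := rfl

lemma nerveMap_comp (F : C ⥤ D) (G : D ⥤ B) : nerveMap (F ⋙ G) = nerveMap F ≫ nerveMap G := rfl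

lemma nerveMap_id : nerveMap (𝟭 C) = 𝟙 (nerve C) := rfl

/-- The functor on a cylinder given by a natural transformation. -/
def cylFunctor {F G : C ⥤ D} (α : F ⟶ G) : C × Fin 2 ⥤ D :=
  Functor.uncurry.obj (ComposableArrows.mk₁ α : ComposableArrows (C ⥤ D) 1).flip

/-- The homotopy on nerves given by a natural transformation. -/
def nerveHomotopy {F G : C ⥤ D} (α : F ⟶ G) : nerve C ⊗ Δ[1] ⟶ nerve D :=
  mkHom (fun m z ↦ Functor.prod' (show Fin (m.unop.len + 1) ⥤ C from z.1)
    (stdSimplex.asOrderHom z.2).monotone.functor ⋙ cylFunctor α)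
    (fun _ _ _ _ ↦ rfl)

lemma ι₀_nerveHomotopy {F G : C ⥤ D} (α : F ⟶ G) :
    SSet.ι₀ ≫ nerveHomotopy α = nerveMap F := by
  apply sset_hom_ext
  intro m X
  refine CategoryTheory.Functor.ext (fun i ↦ rfl) ?_
  intro i j f
  have : (F.map (X.map f) ≫ 𝟙 (F.obj (X.obj j))) =
    𝟙 _ ≫ F.map (X.map f) ≫ 𝟙 _ := by simp
  exact this

lemma ι₁_nerveHomotopy {F G : C ⥤ D} (α : F ⟶ G) :
    SSet.ι₁ ≫ nerveHomotopy α = nerveMap G := by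
  apply sset_hom_ext
  intro m X
  refine CategoryTheory.Functor.ext (fun i ↦ rfl) ?_
  intro i j f
  have : (G.map (X.map f) ≫ 𝟙 (G.obj (X.obj j))) =
    𝟙 _ ≫ G.map (X.map f) ≫ 𝟙 _ := by simp
  exact this

lemma nerveHomotopy_obj {F G : C ⥤ D} (α : F ⟶ G) {m} (z : (nerve C ⊗ Δ[1]).obj m)
    (i : Fin (m.unop.len + 1)) :
    ((nerveHomotopy α).app m z).obj i = F.obj (z.1.obj i) ∨
      ((nerveHomotopy α).app m z).obj i = G.obj (z.1.obj i) := by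
  change ((ComposableArrows.mk₁ α).obj (stdSimplex.asOrderHom z.2 i)).obj (z.1.obj i) = _ ∨
    ((ComposableArrows.mk₁ α).obj (stdSimplex.asOrderHom z.2 i)).obj (z.1.obj i) = _
  generalize stdSimplex.asOrderHom z.2 i = e
  match e with
  | 0 => exact .inl rfl
  | 1 => exact .inr rfl

lemma shomotopy_nerveMap {F G : C ⥤ D} (α : F ⟶ G) : SHomotopy (nerveMap F) (nerveMap G) :=
  .of_tensor _ (ι₀_nerveHomotopy α) (ι₁_nerveHomotopy α)

/-- A functor with a section up to a natural transformation induces a weak equivalence. -/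
lemma weq_nerveMap_of_section {F : C ⥤ D} {G : D ⥤ C} (h : G ⋙ F = 𝟭 D)
    (hα : Nonempty (F ⋙ G ⟶ 𝟭 C) ∨ Nonempty (𝟭 C ⟶ F ⋙ G)) :
    IsWeakHomotopyEquiv (nerveMap F) := by
  refine .of_homotopyInverse (g := nerveMap G) ?_ ?_
  · obtain ⟨⟨α⟩⟩ | ⟨⟨α⟩⟩ := hα
    · exact (shomotopy_nerveMap α).htpy
    · exact (shomotopy_nerveMap α).htpy.symm
  · rw [← nerveMap_comp, h, nerveMap_id]
    exact .refl _

lemma weq_nerveMap_of_isEquivalence (F : C ⥤ D) [F.IsEquivalence] :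
    IsWeakHomotopyEquiv (nerveMap F) :=
  .of_homotopyInverse (g := nerveMap F.inv)
    (shomotopy_nerveMap F.asEquivalence.unitIso.inv).htpy
    (shomotopy_nerveMap F.asEquivalence.counitIso.hom).htpy

end NerveHomotopy

section JoinCell

open MonoidalCategory CartesianMonoidalCategory Simplicial SSet
open scoped CategoryTheory.Join

variable {S : Type w} [SmallCategory S] {q : ℕ}

/-- The simplices of the nerve of a join `S ⋆ Fin (q + 1)` which miss some object of the
right hand side. -/
def joinBoundary (S : Type w) [SmallCategory S] (q : ℕ) :
    (nerve (S ⋆ Fin (q + 1))).Subcomplex where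
  obj m := {X | ∃ j : Fin (q + 1), ∀ i, X.obj i ≠ Join.right j}
  map θ := by
    rintro X ⟨j, hj⟩
    exact ⟨j, fun i ↦ hj _⟩

/-- An endofunctor of the join which does not create objects of the right hand side. -/
def ReflectsRight (U : S ⋆ Fin (q + 1) ⥤ S ⋆ Fin (q + 1)) : Prop :=
  ∀ x j, U.obj x = Join.right j → x = Join.right j

/-- The restriction of an endofunctor of the join to the boundary. -/
def joinBoundaryMap (U : S ⋆ Fin (q + 1) ⥤ S ⋆ Fin (q + 1)) (hU : ReflectsRight U) :
    (joinBoundary S q : SSet) ⟶ (joinBoundary S q : SSet) :=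
  mkHom (fun m X ↦ ⟨(nerveMap U).app m X.1, by
    obtain ⟨j, hj⟩ := X.2
    exact ⟨j, fun i h ↦ hj i (hU _ _ h)⟩⟩) (fun _ _ _ _ ↦ rfl)

lemma joinBoundaryMap_ι (U : S ⋆ Fin (q + 1) ⥤ S ⋆ Fin (q + 1)) (hU : ReflectsRight U) :
    joinBoundaryMap U hU ≫ (joinBoundary S q).ι = (joinBoundary S q).ι ≫ nerveMap U := rfl

lemma exists_joinBoundaryHomotopy {U U' : S ⋆ Fin (q + 1) ⥤ S ⋆ Fin (q + 1)}
    (hU : ReflectsRight U) (hU' : ReflectsRight U') (α : U ⟶ U') :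
    ∃ h : (joinBoundary S q : SSet) ⊗ Δ[1] ⟶ (joinBoundary S q : SSet),
      h ≫ (joinBoundary S q).ι = (joinBoundary S q).ι ▷ _ ≫ nerveHomotopy α ∧
      SSet.ι₀ ≫ h = joinBoundaryMap U hU ∧ SSet.ι₁ ≫ h = joinBoundaryMap U' hU' := by
  let h : (joinBoundary S q : SSet) ⊗ Δ[1] ⟶ (joinBoundary S q : SSet) :=
    mkHom (fun m z ↦ ⟨((joinBoundary S q).ι ▷ _ ≫ nerveHomotopy α).app m z, by
      obtain ⟨j, hj⟩ := z.1.2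
      refine ⟨j, fun i h ↦ ?_⟩
      rcases nerveHomotopy_obj α (((joinBoundary S q).ι ▷ Δ[1]).app m z) i with h' | h'
      · exact hj i (hU _ _ (h'.symm.trans h))
      · exact hj i (hU' _ _ (h'.symm.trans h))⟩) (fun m n f z ↦ by
        apply Subtype.ext
        exact congr($(((joinBoundary S q).ι ▷ _ ≫ nerveHomotopy α).naturality f) z))
  have hh : h ≫ (joinBoundary S q).ι = (joinBoundary S q).ι ▷ _ ≫ nerveHomotopy α := rfl
  refine ⟨h, hh, ?_, ?_⟩
  · rw [← cancel_mono (joinBoundary S q).ι, Category.assoc, hh, joinBoundaryMap_ι,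
      ← ι₀_nerveHomotopy α]
    rfl
  · rw [← cancel_mono (joinBoundary S q).ι, Category.assoc, hh, joinBoundaryMap_ι,
      ← ι₁_nerveHomotopy α]
    rfl

section

variable {P Q : SSet.{w}} {p : P ⟶ Q} (hp : modelCategoryQuillen.J.rlp p)
  (f : (joinBoundary S q : SSet) ⟶ P) (g : nerve (S ⋆ Fin (q + 1)) ⟶ Q)
  (hfg : f ≫ p = (joinBoundary S q).ι ≫ g)

include hp hfg in
lemma exists_lift_of_natTrans_right {U U' : S ⋆ Fin (q + 1) ⥤ S ⋆ Fin (q + 1)}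
    (hU : ReflectsRight U) (hU' : ReflectsRight U') (α : U ⟶ U')
    (l : nerve (S ⋆ Fin (q + 1)) ⟶ P)
    (hl : (joinBoundary S q).ι ≫ l = joinBoundaryMap U hU ≫ f)
    (hl' : l ≫ p = nerveMap U ≫ g) :
    ∃ l' : nerve (S ⋆ Fin (q + 1)) ⟶ P,
      (joinBoundary S q).ι ≫ l' = joinBoundaryMap U' hU' ≫ f ∧ l' ≫ p = nerveMap U' ≫ g := by
  obtain ⟨h, h₁, h₂, h₃⟩ := exists_joinBoundaryHomotopy hU hU' α
  obtain ⟨k, k₁, k₂, k₃⟩ := exists_homotopy_lift₀ (joinBoundary S q).ι hp l (h ≫ f)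
    (nerveHomotopy α ≫ g) (by rw [hl, ← h₂, Category.assoc])
    (by rw [hl', ← ι₀_nerveHomotopy α, Category.assoc])
    (by rw [Category.assoc, hfg, reassoc_of% h₁])
  refine ⟨SSet.ι₁ ≫ k, ?_, ?_⟩
  · have : (joinBoundary S q).ι ≫ SSet.ι₁ = SSet.ι₁ ≫ (joinBoundary S q).ι ▷ Δ[1] := rfl
    rw [reassoc_of% this, k₂, ← h₃, Category.assoc]
  · rw [Category.assoc, k₃, ← ι₁_nerveHomotopy α, Category.assoc]

include hp hfg in
lemma exists_lift_of_natTrans_left {U U' : S ⋆ Fin (q + 1) ⥤ S ⋆ Fin (q + 1)}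
    (hU : ReflectsRight U) (hU' : ReflectsRight U') (α : U ⟶ U')
    (l : nerve (S ⋆ Fin (q + 1)) ⟶ P)
    (hl : (joinBoundary S q).ι ≫ l = joinBoundaryMap U' hU' ≫ f)
    (hl' : l ≫ p = nerveMap U' ≫ g) :
    ∃ l' : nerve (S ⋆ Fin (q + 1)) ⟶ P,
      (joinBoundary S q).ι ≫ l' = joinBoundaryMap U hU ≫ f ∧ l' ≫ p = nerveMap U ≫ g := by
  obtain ⟨h, h₁, h₂, h₃⟩ := exists_joinBoundaryHomotopy hU hU' α
  obtain ⟨k, k₁, k₂, k₃⟩ := exists_homotopy_lift₁ (joinBoundary S q).ι hp l (h ≫ f)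
    (nerveHomotopy α ≫ g) (by rw [hl, ← h₃, Category.assoc])
    (by rw [hl', ← ι₁_nerveHomotopy α, Category.assoc])
    (by rw [Category.assoc, hfg, reassoc_of% h₁])
  refine ⟨SSet.ι₀ ≫ k, ?_, ?_⟩
  · have : (joinBoundary S q).ι ≫ SSet.ι₀ = SSet.ι₀ ≫ (joinBoundary S q).ι ▷ Δ[1] := rfl
    rw [reassoc_of% this, k₂, ← h₂, Category.assoc]
  · rw [Category.assoc, k₃, ← ι₀_nerveHomotopy α, Category.assoc]

end

instance (X : S ⋆ Fin (q + 1)) (j : Fin (q + 1)) : Subsingleton (X ⟶ Join.right j) := by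
  match X with
  | .left x => infer_instance
  | .right i => exact inferInstanceAs (Subsingleton (ULift (i ⟶ j)))

/-- Collapsing the left hand side of the join to a new initial vertex. -/
def joinCollapse (S : Type w) [SmallCategory S] (q : ℕ) : S ⋆ Fin (q + 1) ⥤ Fin (q + 2) :=
  Join.mkFunctor ((Functor.const _).obj 0) (Fin.strictMono_succ.monotone.functor)
    { app := fun _ ↦ homOfLE (Fin.zero_le _), naturality := fun _ _ _ ↦ rfl }

/-- The simplex of the nerve of the join with initial vertex `s` on the left. -/
def joinSimplex (q : ℕ) (s : S) : Fin (q + 2) ⥤ S ⋆ Fin (q + 1) :=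
  ComposableArrows.precomp (n := q) (Join.inclRight S (Fin (q + 1))) (Join.edge s 0)

/-- The comparison between collapsing the left hand side to `s` and applying `c`. -/
def joinCollapseTrans {c : S ⥤ S} {s : S} (z : (Functor.const S).obj s ⟶ c) :
    joinCollapse S q ⋙ joinSimplex q s ⟶ Join.mapPair c (𝟭 (Fin (q + 1))) where
  app x := match x with
    | .left x => (Join.inclLeft S (Fin (q + 1))).map (z.app x)
    | .right i => 𝟙 (Join.right i)
  naturality x y f := by
    match y with
    | .right j => exact Subsingleton.elim (α := (_ ⟶ Join.right j)) _ _
    | .left y =>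
      match x with
      | .right i => exact (Join.false_of_right_to_left f).elim
      | .left x =>
        obtain ⟨f, rfl⟩ := (Join.inclLeft S (Fin (q + 1))).map_surjective f
        have h := congrArg (Join.inclLeft S (Fin (q + 1))).map (z.naturality f)
        rw [Functor.map_comp, Functor.map_comp] at h
        refine Eq.trans ?_ h
        exact congrArg (· ≫ (Join.inclLeft S (Fin (q + 1))).map (z.app y))
          ((joinSimplex q s).map_id 0)

lemma joinCollapse_reflectsRight (s : S) :
    ReflectsRight (joinCollapse S q ⋙ joinSimplex q s) := by
  rintro (x | i) j h
  · have h' : (Join.left s : S ⋆ Fin (q + 1)) = Join.right j := h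
    cases h'
  · exact h

lemma mapPair_reflectsRight (c : S ⥤ S) :
    ReflectsRight (Join.mapPair c (𝟭 (Fin (q + 1)))) := by
  rintro (x | i) j h
  · cases h
  · exact h

lemma id_reflectsRight : ReflectsRight (𝟭 (S ⋆ Fin (q + 1))) := fun _ _ h ↦ h

open SSet.modelCategoryQuillen in
/-- If `S` is contracted to `s` by a zigzag of natural transformations, the inclusion of
the boundary of the join is anodyne. -/
lemma joinBoundary_anodyne {c : S ⥤ S} {s : S} (z : (Functor.const S).obj s ⟶ c)
    (z' : 𝟭 S ⟶ c) : anodyneExtensions (joinBoundary S q).ι := by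
  intro P Q p hp
  constructor
  intro f g sq
  have hfg := sq.w
  let σ : (Δ[q + 1] : SSet.{w}) ⟶ nerve (S ⋆ Fin (q + 1)) :=
    mkHom (fun m t ↦ (stdSimplex.asOrderHom t).monotone.functor ⋙ joinSimplex q s)
      (fun _ _ _ _ ↦ rfl)
  let ρ : nerve (S ⋆ Fin (q + 1)) ⟶ Δ[q + 1] :=
    mkHom (fun m X ↦ stdSimplex.objEquiv.symm (SimplexCategory.Hom.mk
      (X ⋙ joinCollapse S q).toOrderHom)) (fun _ _ _ _ ↦ rfl)
  have hρσ : ρ ≫ σ = nerveMap (joinCollapse S q ⋙ joinSimplex q s) := rfl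
  let τ : (Λ[q + 1, 0] : SSet.{w}) ⟶ (joinBoundary S q : SSet) :=
    mkHom (fun m t ↦ ⟨σ.app m t.1, by
      by_contra hn
      refine t.2 (Set.eq_univ_of_forall fun b ↦ ?_)
      obtain rfl | ⟨j, rfl⟩ := Fin.eq_zero_or_eq_succ b
      · exact .inr rfl
      · by_contra hj
        refine hn ⟨j, fun i hi ↦ hj (.inl ⟨i, ?_⟩)⟩
        change (joinSimplex q s).obj (stdSimplex.asOrderHom t.1 i) = Join.right j at hi
        generalize stdSimplex.asOrderHom t.1 i = b at hi
        obtain rfl | ⟨k, rfl⟩ := Fin.eq_zero_or_eq_succ b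
        · cases (show (Join.left s : S ⋆ Fin (q + 1)) = Join.right j from hi)
        · exact congrArg Fin.succ (Join.right.inj
            (show (Join.right k : S ⋆ Fin (q + 1)) = Join.right j from hi))⟩) (fun _ _ _ _ ↦ rfl)
  let ρ' : (joinBoundary S q : SSet) ⟶ Λ[q + 1, 0] :=
    mkHom (fun m X ↦ ⟨ρ.app m X.1, by
      obtain ⟨j, hj⟩ := X.2
      intro hu
      obtain ⟨i, hi⟩ | h := hu.ge (Set.mem_univ j.succ)
      · change (joinCollapse S q).obj (X.1.obj i) = j.succ at hi
        refine hj i ?_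
        generalize X.1.obj i = x at hi
        match x with
        | .left x => exact absurd hi (Fin.succ_ne_zero j).symm
        | .right k => exact congrArg Join.right (Fin.succ_injective _ hi)
      · exact absurd h (Fin.succ_ne_zero j)⟩) (fun _ _ _ _ ↦ rfl)
  have hor : HasLiftingProperty (Λ[q + 1, 0] : (Δ[q + 1] : SSet.{w}).Subcomplex).ι p :=
    anodyneExtensions.horn_ι 0 p hp
  have sq' : CommSq (τ ≫ f) (Λ[q + 1, 0] : (Δ[q + 1] : SSet.{w}).Subcomplex).ι p (σ ≫ g) :=
    ⟨by rw [Category.assoc, hfg]; rfl⟩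
  obtain ⟨l₁, hl₁, hl₁'⟩ := exists_lift_of_natTrans_right hp f g hfg
    (joinCollapse_reflectsRight s) (mapPair_reflectsRight c) (joinCollapseTrans z)
    (ρ ≫ sq'.lift) (by
      have : (joinBoundary S q).ι ≫ ρ = ρ' ≫ (Λ[q + 1, 0] : (Δ[q + 1] : SSet.{w}).Subcomplex).ι := rfl
      rw [reassoc_of% this, sq'.fac_left]
      rfl) (by rw [Category.assoc, sq'.fac_right, ← hρσ, Category.assoc])
  obtain ⟨l₂, hl₂, hl₂'⟩ := exists_lift_of_natTrans_left hp f g hfg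
    id_reflectsRight (mapPair_reflectsRight c)
    (Join.mkNatTrans (F := 𝟭 _) (F' := Join.mapPair c (𝟭 (Fin (q + 1))))
      (Functor.whiskerRight z' (Join.inclLeft _ _)) (𝟙 (Join.inclRight S _)) (by
        ext ⟨x, i⟩
        exact Subsingleton.elim (α := (_ ⟶ Join.right i)) _ _)) l₁ hl₁ hl₁'
  exact ⟨⟨⟨l₂, hl₂, hl₂'⟩⟩⟩

end JoinCell

section Exhaustion

open SSet

/-- A partial solution of a lifting problem, defined on a subcomplex. -/
structure PartialLift {Z P Q : SSet.{w}} (F : Set Z.Subcomplex) (L₀ : Z.Subcomplex) (p : P ⟶ Q)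
    (f : (L₀ : SSet) ⟶ P) (g : Z ⟶ Q) where
  dom : Z.Subcomplex
  mem : dom ∈ F
  le : L₀ ≤ dom
  lift : (dom : SSet) ⟶ P
  fac_left : Subcomplex.homOfLE le ≫ lift = f
  fac_right : lift ≫ p = dom.ι ≫ g

/-- The extension relation on partial lifts. -/
def PartialLift.Rel {Z P Q : SSet.{w}} {F : Set Z.Subcomplex} {L₀ : Z.Subcomplex} {p : P ⟶ Q}
    {f : (L₀ : SSet) ⟶ P} {g : Z ⟶ Q} (l l' : PartialLift F L₀ p f g) : Prop :=
  ∃ h : l.dom ≤ l'.dom, Subcomplex.homOfLE h ≫ l'.lift = l.lift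

lemma PartialLift.exists_upperBound {Z P Q : SSet.{w}} {F : Set Z.Subcomplex} {L₀ : Z.Subcomplex}
    {p : P ⟶ Q} {f : (L₀ : SSet) ⟶ P} {g : Z ⟶ Q}
    (hF : ∀ c ⊆ F, IsChain (· ≤ ·) c → c.Nonempty → sSup c ∈ F)
    (c : Set (PartialLift F L₀ p f g)) (hc : IsChain PartialLift.Rel c) (hne : c.Nonempty) :
    ∃ ub, ∀ l ∈ c, PartialLift.Rel l ub := by
  classical
  let D : Set Z.Subcomplex := PartialLift.dom '' c
  have hmem : ∀ m (x : Z.obj m), x ∈ (sSup D).obj m → ∃ l ∈ c, x ∈ l.dom.obj m := by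
    intro m x hx
    rw [Subfunctor.sSup_obj] at hx
    simpa [D] using hx
  have hval : ∀ l ∈ c, ∀ l' ∈ c, ∀ m (x : Z.obj m) (h : x ∈ l.dom.obj m) (h' : x ∈ l'.dom.obj m),
      l.lift.app m ⟨x, h⟩ = l'.lift.app m ⟨x, h'⟩ := by
    intro l hl l' hl' m x h h'
    by_cases e : l = l'
    · subst e; rfl
    · obtain ⟨i, hi⟩ | ⟨i, hi⟩ := hc hl hl' e
      · exact congr($(hi).app m ⟨x, h⟩).symm
      · exact congr($(hi).app m ⟨x, h'⟩)
  choose F' hF' hF'' using hmem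
  let L : ((sSup D : Z.Subcomplex) : SSet) ⟶ P :=
    { app := fun m ↦ ↾fun x ↦ (F' m x.1 x.2).lift.app m ⟨x.1, hF'' m x.1 x.2⟩
      naturality := by
        intro m n θ
        ext x
        refine Eq.trans ?_ congr($((F' m x.1 x.2).lift.naturality θ) ⟨x.1, hF'' m x.1 x.2⟩)
        exact hval _ (hF' _ _ _) _ (hF' _ _ _) _ _ _ _ }
  have hle : ∀ l ∈ c, l.dom ≤ sSup D := fun l hl ↦ le_sSup ⟨l, hl, rfl⟩
  have hL : ∀ l (hl : l ∈ c), Subcomplex.homOfLE (hle l hl) ≫ L = l.lift := by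
    intro l hl
    ext m x
    exact hval _ (hF' _ _ _) _ hl _ _ _ _
  obtain ⟨l₀, hl₀⟩ := hne
  refine ⟨⟨sSup D, hF D ?_ ?_ ⟨_, l₀, hl₀, rfl⟩, l₀.le.trans (hle _ hl₀), L, ?_, ?_⟩,
    fun l hl ↦ ⟨hle l hl, hL l hl⟩⟩
  · rintro _ ⟨l, -, rfl⟩
    exact l.mem
  · rintro _ ⟨l, hl, rfl⟩ _ ⟨l', hl', rfl⟩ hne
    obtain ⟨i, -⟩ | ⟨i, -⟩ := hc hl hl' (fun e ↦ hne (by rw [e]))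
    · exact .inl i
    · exact .inr i
  · exact (congrArg (Subcomplex.homOfLE l₀.le ≫ ·) (hL l₀ hl₀)).trans l₀.fac_left
  · ext m x
    exact congr($((F' m x.1 x.2).fac_right).app m ⟨x.1, hF'' m x.1 x.2⟩)

open SSet.modelCategoryQuillen in
/-- A transfinite exhaustion of a simplicial set by anodyne extensions is anodyne. -/
lemma anodyne_of_exhaustion {Z : SSet.{w}} (F : Set Z.Subcomplex) (L₀ : Z.Subcomplex)
    (h₀ : L₀ ∈ F) (hF : ∀ c ⊆ F, IsChain (· ≤ ·) c → c.Nonempty → sSup c ∈ F)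
    (hstep : ∀ L ∈ F, L ≠ ⊤ → ∃ L' ∈ F, ∃ h : L < L',
      anodyneExtensions (Subcomplex.homOfLE h.le)) :
    anodyneExtensions L₀.ι := by
  intro P Q p hp
  constructor
  intro f g sq
  let l₀ : PartialLift F L₀ p f g := ⟨L₀, h₀, le_rfl, f, rfl, sq.w⟩
  obtain ⟨l, hl⟩ := exists_maximal_of_chains_bounded (r := PartialLift.Rel (L₀ := L₀) (p := p))
    (fun c hc ↦ by
      rcases c.eq_empty_or_nonempty with rfl | hne
      · exact ⟨l₀, fun _ h ↦ h.elim⟩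
      · exact PartialLift.exists_upperBound (f := f) (g := g) hF c hc hne)
    (by
      rintro a b c ⟨h, e⟩ ⟨h', e'⟩
      exact ⟨h.trans h', by rw [← e, ← e']; rfl⟩)
  have htop : l.dom = ⊤ := by
    by_contra hne
    obtain ⟨L', hL', h, hi⟩ := hstep _ l.mem hne
    have := hi p hp
    have sq' : CommSq l.lift (Subcomplex.homOfLE h.le) p (L'.ι ≫ g) := ⟨l.fac_right⟩
    let l' : PartialLift F L₀ p f g := ⟨L', hL', l.le.trans h.le, sq'.lift, by
      have e := l.fac_left
      rw [← sq'.fac_left] at e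
      exact e, sq'.fac_right⟩
    obtain ⟨h', -⟩ := hl l' ⟨h.le, sq'.fac_left⟩
    exact h.not_ge h'
  have hmem : ∀ m (x : Z.obj m), x ∈ l.dom.obj m := by
    intro m x
    rw [htop]
    trivial
  let k : Z ⟶ (l.dom : SSet) := mkHom (fun m x ↦ ⟨x, hmem m x⟩) (fun _ _ _ _ ↦ rfl)
  refine ⟨⟨⟨k ≫ l.lift, ?_, ?_⟩⟩⟩
  · exact l.fac_left
  · rw [Category.assoc, l.fac_right]
    rfl

open SSet.modelCategoryQuillen in
/-- Attaching a simplicial set along an anodyne extension, in terms of subcomplexes. -/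
lemma anodyne_homOfLE_of_attach {Z K : SSet.{w}} (L L' : Z.Subcomplex) (h : L ≤ L')
    (V : K.Subcomplex) (hV : anodyneExtensions V.ι) (g : K ⟶ Z)
    (hgL : ∀ m (x : K.obj m), x ∈ V.obj m ↔ g.app m x ∈ L.obj m)
    (hgL' : ∀ m (z : Z.obj m), z ∈ L'.obj m ↔ z ∈ L.obj m ∨ ∃ x, g.app m x = z)
    (hinj : ∀ m (x y : K.obj m), x ∉ V.obj m → g.app m x = g.app m y → x = y) :
    anodyneExtensions (Subcomplex.homOfLE h) := by
  classical
  intro P Q p hp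
  constructor
  intro f k sq
  have := hV p hp
  let gV : (V : SSet) ⟶ (L : SSet) :=
    mkHom (fun m x ↦ ⟨g.app m x.1, (hgL m x.1).1 x.2⟩) (fun m n θ x ↦ by
      apply Subtype.ext
      exact congr($(g.naturality θ) x.1))
  let gK : K ⟶ (L' : SSet) :=
    mkHom (fun m x ↦ ⟨g.app m x, (hgL' m _).2 (.inr ⟨x, rfl⟩)⟩) (fun m n θ x ↦ by
      apply Subtype.ext
      exact congr($(g.naturality θ) x))
  have sq' : CommSq (gV ≫ f) V.ι p (gK ≫ k) := ⟨by
    rw [Category.assoc, sq.w]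
    rfl⟩
  let e := sq'.lift
  have he : ∀ m (x : K.obj m) (hx : g.app m x ∈ L.obj m), e.app m x = f.app m ⟨_, hx⟩ := by
    intro m x hx
    exact congr($(sq'.fac_left).app m ⟨x, (hgL m x).2 hx⟩)
  have hex : ∀ m (z : (L' : SSet).obj m), z.1 ∉ L.obj m → ∃ x, g.app m x = z.1 :=
    fun m z hz ↦ ((hgL' m z.1).1 z.2).resolve_left hz
  let l₀ : ∀ m, (L' : SSet).obj m → P.obj m := fun m z ↦
    if hz : z.1 ∈ L.obj m then f.app m ⟨z.1, hz⟩ else e.app m (hex m z hz).choose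
  have hl : ∀ m (z : (L' : SSet).obj m) (hz : z.1 ∈ L.obj m), l₀ m z = f.app m ⟨z.1, hz⟩ :=
    fun m z hz ↦ dif_pos hz
  have hl' : ∀ m (x : K.obj m), l₀ m (gK.app m x) = e.app m x := by
    intro m x
    by_cases hx : g.app m x ∈ L.obj m
    · rw [hl _ _ hx, he _ _ hx]
      rfl
    · refine (dif_neg hx).trans ?_
      have hc := (hex m (gK.app m x) hx).choose_spec
      exact congrArg (e.app m) (hinj m x _ (fun hV ↦ hx ((hgL _ _).1 hV)) hc.symm).symm
  have hcases : ∀ m (z : (L' : SSet).obj m), z.1 ∈ L.obj m ∨ ∃ x, gK.app m x = z := by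
    intro m z
    refine ((hgL' m z.1).1 z.2).imp_right ?_
    rintro ⟨x, hx⟩
    exact ⟨x, Subtype.ext hx⟩
  let l : (L' : SSet) ⟶ P := mkHom l₀ (by
    intro m n θ z
    rcases hcases m z with hz | ⟨x, rfl⟩
    · rw [hl _ _ hz, hl _ ((L' : SSet).map θ z) (L.map θ hz)]
      exact congr($(f.naturality θ) ⟨z.1, hz⟩)
    · rw [hl']
      refine Eq.trans ?_ congr($(e.naturality θ) x)
      refine Eq.trans ?_ (hl' _ _)
      exact congrArg (l₀ n) congr($(gK.naturality θ) x).symm)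
  refine ⟨⟨⟨l, ?_, ?_⟩⟩⟩
  · ext m z
    exact hl m _ z.2
  · ext m z
    rcases hcases m z with hz | ⟨x, rfl⟩
    · refine (congrArg (p.app m) (hl m z hz)).trans ?_
      exact congr($(sq.w).app m ⟨z.1, hz⟩)
    · refine (congrArg (p.app m) (hl' m x)).trans ?_
      exact congr($(sq'.fac_right).app m x)

end Exhaustion

section FunctorEquality

lemma exists_comp_eq_of_full {A : Type*} {C : Type*} {D : Type*} [Category* A] [Category* C]
    [Category* D] (X : A ⥤ D) (ι : C ⥤ D) [ι.Full] [ι.Faithful]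
    (h : ∀ a, ∃ c, ι.obj c = X.obj a) : ∃ X' : A ⥤ C, X' ⋙ ι = X := by
  choose o ho using h
  let fι := Functor.FullyFaithful.ofFullyFaithful ι
  refine ⟨{ obj := o, map := fun f ↦ fι.preimage (eqToHom (ho _) ≫ X.map f ≫ eqToHom (ho _).symm),
            map_id := ?_, map_comp := ?_ }, ?_⟩
  · intro a
    apply ι.map_injective
    simp
  · intro a b c f g
    apply ι.map_injective
    simp
  · exact CategoryTheory.Functor.ext ho (by simp)

lemma comp_left_injective {A : Type*} {C : Type*} {D : Type*} [Category* A] [Category* C]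
    [Category* D] {X X' : A ⥤ C} (ι : C ⥤ D) [ι.Faithful]
    (hι : Function.Injective ι.obj) (h : X ⋙ ι = X' ⋙ ι) : X = X' := by
  have ho : ∀ a, X.obj a = X'.obj a := fun a ↦ hι (Functor.congr_obj h a)
  refine CategoryTheory.Functor.ext ho fun a b f ↦ ι.map_injective ?_
  have := Functor.congr_hom h f
  simpa [eqToHom_map] using this

lemma functor_ext_of_thin {A : Type*} {D : Type*} [Category* A] [Category* D] [Quiver.IsThin D]
    {X X' : A ⥤ D} (h : ∀ a, X.obj a = X'.obj a) : X = X' :=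
  CategoryTheory.Functor.ext h fun _ _ _ ↦ Subsingleton.elim _ _

end FunctorEquality

section Cograph

variable {T B : Type w} [SmallCategory T] [SmallCategory B]

/-- The cograph of a functor `F : T ⥤ B`, i.e. the objects of `T` and `B` together with
morphisms `F t ⟶ b` as morphisms from `t` to `b`. -/
inductive Cograph (F : T ⥤ B) : Type w
  | top (t : T)
  | base (b : B)

namespace Cograph

variable {F : T ⥤ B}

/-- The morphisms of the cograph. -/
def Hom : Cograph F → Cograph F → Type w
  | top t, top t' => t ⟶ t'
  | top t, base b => F.obj t ⟶ b
  | base b, base b' => b ⟶ b'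
  | base _, top _ => PEmpty

instance : SmallCategory (Cograph F) where
  Hom := Hom
  id x := match x with
    | top t => 𝟙 t
    | base b => 𝟙 b
  comp {x y z} f g := match x, y, z, f, g with
    | top _, top _, top _, f, g => f ≫ g
    | top _, top _, base _, f, g => F.map f ≫ g
    | top _, base _, base _, f, g => f ≫ g
    | base _, base _, base _, f, g => f ≫ g
    | top _, base _, top _, _, g => g.elim
    | base _, top _, _, f, _ => f.elim
    | base _, base _, top _, _, g => g.elim
  id_comp {x y} f := by
    rcases x with x | x <;> rcases y with y | y <;>
      first
        | exact f.elim
        | exact Category.id_comp (obj := T) _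
        | exact Category.id_comp (obj := B) _
        | exact (congrArg (fun k ↦ CategoryStruct.comp (X := F.obj x) (Y := F.obj x) (Z := y) k f)
            (F.map_id x)).trans (Category.id_comp (obj := B) _)
  comp_id {x y} f := by
    rcases x with x | x <;> rcases y with y | y <;>
      first
        | exact f.elim
        | exact Category.comp_id (obj := T) _
        | exact Category.comp_id (obj := B) _
  assoc {x y z t} f g h := by
    rcases x with x | x <;> rcases y with y | y <;> rcases z with z | z <;> rcases t with t | t <;>
      first
        | exact f.elim | exact g.elim | exact h.elim
        | exact Category.assoc (obj := T) _ _ _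
        | exact Category.assoc (obj := B) _ _ _
        | exact (congrArg (fun k ↦ CategoryStruct.comp (X := F.obj x) (Y := F.obj z) (Z := t) k h)
            (F.map_comp (X := x) (Y := y) (Z := z) f g)).trans (Category.assoc (obj := B) _ _ _)

variable (F)

/-- The inclusion of the source of a functor in its cograph. -/
def inclTop : T ⥤ Cograph F where
  obj := top
  map f := f

/-- The inclusion of the target of a functor in its cograph. -/
def inclBase : B ⥤ Cograph F where
  obj := base
  map f := f

instance : (inclTop F).Faithful := ⟨fun h ↦ h⟩
instance : (inclTop F).Full := ⟨fun f ↦ ⟨f, rfl⟩⟩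
instance : (inclBase F).Faithful := ⟨fun h ↦ h⟩
instance : (inclBase F).Full := ⟨fun f ↦ ⟨f, rfl⟩⟩

lemma inclTop_injective : Function.Injective (inclTop F).obj := fun _ _ ↦ top.inj

/-- The retraction of the cograph of a functor to its target. -/
def ret : Cograph F ⥤ B where
  obj x := match x with
    | top t => F.obj t
    | base b => b
  map {x y} f := match x, y, f with
    | top _, top _, f => F.map f
    | top _, base _, f => f
    | base _, base _, f => f
    | base _, top _, f => f.elim
  map_id x := by
    rcases x with x | x
    · exact F.map_id x
    · rfl
  map_comp {x y z} f g := by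
    rcases x with x | x <;> rcases y with y | y <;> rcases z with z | z <;>
      first
        | exact f.elim | exact g.elim | rfl | exact F.map_comp (X := x) (Y := y) (Z := z) f g

/-- The homotopy between the identity of the cograph and the retraction to the target. -/
def toRet : 𝟭 (Cograph F) ⟶ ret F ⋙ inclBase F where
  app x := match x with
    | top t => (𝟙 (F.obj t) : F.obj t ⟶ F.obj t)
    | base b => (𝟙 b : b ⟶ b)
  naturality x y f := by
    rcases x with x | x <;> rcases y with y | y
    · exact (Category.comp_id (obj := B) (F.map (X := x) (Y := y) f)).trans
        (Category.id_comp (obj := B) _).symm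
    · exact (Category.comp_id (obj := B) (X := F.obj x) (Y := y) f).trans
        (Category.id_comp (obj := B) _).symm
    · exact f.elim
    · exact (Category.comp_id (obj := B) (X := x) (Y := y) f).trans
        (Category.id_comp (obj := B) _).symm

lemma weq_nerveMap_ret : IsWeakHomotopyEquiv (nerveMap (ret F)) :=
  weq_nerveMap_of_section (G := inclBase F) rfl (.inr ⟨toRet F⟩)

variable {F}

lemma false_of_base_to_top {b : B} {t : T} (f : (base b : Cograph F) ⟶ top t) : False :=
  f.elim

open scoped CategoryTheory.Join

/-- The functor from a join to the cograph determined by a chain of morphisms in `B`. -/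
def joinFunctor {q : ℕ} (b : Fin (q + 1) ⥤ B) :
    CostructuredArrow F (b.obj 0) ⋆ Fin (q + 1) ⥤ Cograph F :=
  Join.mkFunctor (CostructuredArrow.proj F _ ⋙ inclTop F) (b ⋙ inclBase F)
    { app := fun x ↦ (show F.obj x.1.left ⟶ b.obj x.2 from
        x.1.hom ≫ b.map (homOfLE (Fin.zero_le _)))
      naturality := fun x y f ↦ by
        change F.map f.1.left ≫ y.1.hom ≫ b.map _ = (x.1.hom ≫ b.map _) ≫ b.map f.2
        rw [← Category.assoc, CostructuredArrow.w, Category.assoc, ← b.map_comp]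
        rfl }

instance {q : ℕ} (b : Fin (q + 1) ⥤ B) : (joinFunctor (F := F) b).Faithful where
  map_injective {x y f g} h := by
    match x, y, f, g with
    | _, .right _, f, g => exact Subsingleton.elim _ _
    | .right _, .left _, f, _ => exact (Join.false_of_right_to_left f).elim
    | .left x, .left y, .up f, .up g => exact congrArg ULift.up (CostructuredArrow.hom_ext f g h)

lemma joinFunctor_map_edge {q : ℕ} (b : Fin (q + 1) ⥤ B) (x : CostructuredArrow F (b.obj 0))
    (f : (Join.left x : CostructuredArrow F (b.obj 0) ⋆ Fin (q + 1)) ⟶ Join.right 0) :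
    (joinFunctor b).map f = (show F.obj x.left ⟶ b.obj 0 from x.hom) := by
  have : f = Join.edge _ _ := Subsingleton.elim _ _
  subst this
  change x.hom ≫ b.map (𝟙 _) = x.hom
  simp

/-- Left objects of the join are determined by their structure maps in the cograph. -/
lemma joinFunctor_ext_left {q : ℕ} (b : Fin (q + 1) ⥤ B)
    {x x' y y' : CostructuredArrow F (b.obj 0) ⋆ Fin (q + 1)} (h : x ⟶ y) (h' : x' ⟶ y')
    (hy : y = .right 0) (hy' : y' = .right 0)
    (hx : (∃ s, x = .left s) ∧ ∃ s, x' = .left s)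
    (e : (joinFunctor b).obj x = (joinFunctor b).obj x')
    (eh : HEq ((joinFunctor b).map h) ((joinFunctor b).map h')) : x = x' := by
  subst hy hy'
  obtain ⟨⟨s, rfl⟩, s', rfl⟩ := hx
  rw [joinFunctor_map_edge, joinFunctor_map_edge] at eh
  obtain ⟨t, ⟨⟨⟩⟩, f⟩ := s
  obtain ⟨t', ⟨⟨⟩⟩, f'⟩ := s'
  obtain rfl : t = t' := top.inj e
  obtain rfl : f = f' := eq_of_heq eh
  rfl

end Cograph

end Cograph

section JoinCut

open scoped CategoryTheory.Join

instance {A B : Type*} [Category* A] [Category* B] [Quiver.IsThin A] [Quiver.IsThin B] :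
    Quiver.IsThin (A ⋆ B) := fun x y ↦ ⟨fun f g ↦ by
  match x, y, f, g with
  | .left _, .left _, .up f, .up g => exact congrArg ULift.up (Subsingleton.elim f g)
  | .right _, .right _, .up f, .up g => exact congrArg ULift.up (Subsingleton.elim f g)
  | .left _, .right _, _, _ => rfl⟩

/-- A preorder cut along a lower set maps to the join of the two pieces. -/
noncomputable def joinCut {N : Type*} [Preorder N] (P : N → Prop) (hP : ∀ i j, i ≤ j → P j → P i) :
    N ⥤ {i // P i} ⋆ {i // ¬ P i} := by
  classical
  exact
  { obj := fun i ↦ if h : P i then .left ⟨i, h⟩ else .right ⟨i, h⟩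
    map := fun {i j} f ↦ Nonempty.some (by
      by_cases hi : P i
      · by_cases hj : P j
        · rw [dif_pos hi, dif_pos hj]
          exact ⟨(Join.inclLeft _ _).map (homOfLE (show (⟨i, hi⟩ : {i // P i}) ≤ ⟨j, hj⟩ from f.le))⟩
        · rw [dif_pos hi, dif_neg hj]
          exact ⟨Join.edge _ _⟩
      · have hj : ¬ P j := fun hj ↦ hi (hP i j f.le hj)
        rw [dif_neg hi, dif_neg hj]
        exact ⟨(Join.inclRight _ _).map
          (homOfLE (show (⟨i, hi⟩ : {i // ¬ P i}) ≤ ⟨j, hj⟩ from f.le))⟩)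
    map_id := fun _ ↦ Subsingleton.elim _ _
    map_comp := fun _ _ ↦ Subsingleton.elim _ _ }

/-- The inverse of cutting a preorder along a lower set. -/
def joinUncut {N : Type*} [Preorder N] (P : N → Prop)
    (h : ∀ i j, P i → ¬ P j → i ≤ j) : {i // P i} ⋆ {i // ¬ P i} ⥤ N :=
  Join.mkFunctor (Subtype.mono_coe _).functor (Subtype.mono_coe _).functor
    { app := fun x ↦ homOfLE (h _ _ x.1.2 x.2.2), naturality := fun _ _ _ ↦ rfl }

lemma joinCut_joinUncut {N : Type*} [Preorder N] (P : N → Prop) (hP h) :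
    joinCut (N := N) P hP ⋙ joinUncut P h = 𝟭 N := by
  refine functor_ext_of_thin fun i ↦ ?_
  by_cases hi : P i
  · have : (joinCut P hP).obj i = .left ⟨i, hi⟩ := dif_pos hi
    exact congrArg (joinUncut P h).obj this
  · have : (joinCut P hP).obj i = .right ⟨i, hi⟩ := dif_neg hi
    exact congrArg (joinUncut P h).obj this

lemma exists_eq_mkFunctor {A B E : Type*} [Category* A] [Category* B] [Category* E]
    (Φ : A ⋆ B ⥤ E) (G : A ⥤ E) (H : B ⥤ E) (hG : G = Join.inclLeft A B ⋙ Φ)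
    (hH : H = Join.inclRight A B ⋙ Φ) :
    ∃ α : CategoryTheory.Prod.fst A B ⋙ G ⟶ CategoryTheory.Prod.snd A B ⋙ H, Φ = Join.mkFunctor G H α := by
  subst hG hH
  refine ⟨Functor.whiskerRight (Join.edgeTransform A B) Φ, ?_⟩
  refine CategoryTheory.Functor.ext (fun x ↦ ?_) ?_
  · cases x <;> rfl
  · intro x y f
    match x, y, f with
    | .left x, .left y, .up f =>
      exact ((Category.id_comp _).trans (Category.comp_id _)).symm
    | .right x, .right y, .up f =>
      exact ((Category.id_comp _).trans (Category.comp_id _)).symm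
    | .left x, .right y, f =>
      refine Eq.trans ?_ ((Category.id_comp _).trans (Category.comp_id _)).symm
      exact congrArg Φ.map (Subsingleton.elim _ _)

end JoinCut

namespace Cograph

open scoped CategoryTheory.Join

variable {T B : Type w} [SmallCategory T] [SmallCategory B] {F : T ⥤ B}

lemma isTop_of_hom {x y : Cograph F} (f : x ⟶ y) (hy : ∃ t, y = top t) : ∃ t, x = top t := by
  obtain ⟨t, rfl⟩ := hy
  match x, f with
  | top t', _ => exact ⟨t', rfl⟩
  | base b, f => exact (false_of_base_to_top f).elim

lemma not_isTop_iff {x : Cograph F} : (¬ ∃ t, x = top t) ↔ ∃ b, x = base b := by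
  match x with
  | top t => simp
  | base b => simp

lemma exists_comp_joinFunctor {n q : ℕ} (X : Fin (n + 1) ⥤ Cograph F) (b : Fin (q + 1) ⥤ B)
    (Xr : {i // ¬ ∃ t, X.obj i = top t} ⥤ Fin (q + 1))
    (hXr : Xr ⋙ b ⋙ inclBase F = (Subtype.mono_coe _).functor ⋙ X)
    (c : {i // ¬ ∃ t, X.obj i = top t}) (hc : ∀ i, c ≤ i) (hc₀ : Xr.obj c = 0) :
    ∃ v : Fin (n + 1) ⥤ CostructuredArrow F (b.obj 0) ⋆ Fin (q + 1), v ⋙ joinFunctor b = X := by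
  let P : Fin (n + 1) → Prop := fun i ↦ ∃ t, X.obj i = top t
  have hP : ∀ i j, i ≤ j → P j → P i := fun i j h hj ↦ isTop_of_hom (X.map (homOfLE h)) hj
  let cut := joinCut P hP
  let uncut := joinUncut P
    (fun i j hi hj ↦ (le_total i j).resolve_right (fun h ↦ hj (hP j i h hi)))
  have hcut : cut ⋙ uncut = 𝟭 _ := joinCut_joinUncut _ _ _
  obtain ⟨Xl, hXl⟩ := exists_comp_eq_of_full (Join.inclLeft {i // P i} {i // ¬ P i} ⋙ uncut ⋙ X)
    (inclTop F) (fun i ↦ by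
      obtain ⟨t, ht⟩ := i.2
      exact ⟨t, ht.symm⟩)
  obtain ⟨α, hα⟩ := exists_eq_mkFunctor (uncut ⋙ X) _ _ hXl hXr
  obtain ⟨a, ha⟩ : ∃ a : ∀ i j, F.obj (Xl.obj i) ⟶ b.obj (Xr.obj j), ∀ i j, α.app (i, j) = a i j :=
    ⟨fun i j ↦ α.app (i, j), fun _ _ ↦ rfl⟩
  have hnat : ∀ {i i' j j'} (f : i ⟶ i') (g : j ⟶ j'),
      F.map (Xl.map f) ≫ a i' j' = a i j ≫ b.map (Xr.map g) := by
    intro i i' j j' f g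
    rw [← ha, ← ha]
    exact α.naturality (X := (i, j)) (Y := (i', j')) (f, g)
  have hα' : ∀ i j, a i j = a i c ≫ b.map (Xr.map (homOfLE (hc j))) := by
    intro i j
    rw [← hnat (𝟙 i) (homOfLE (hc j)), Xl.map_id, F.map_id, Category.id_comp]
  let l : {i // P i} ⥤ CostructuredArrow F (b.obj 0) :=
    { obj := fun i ↦ CostructuredArrow.mk (Y := Xl.obj i) (S := F)
        (a i c ≫ b.map (homOfLE hc₀.le))
      map := fun {i i'} f ↦ CostructuredArrow.homMk (Xl.map f) (by
        have h := hnat f (𝟙 c)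
        dsimp
        rw [reassoc_of% h]
        simp)
      map_id := fun i ↦ CostructuredArrow.hom_ext _ _ (Xl.map_id i)
      map_comp := fun f g ↦ CostructuredArrow.hom_ext _ _ (Xl.map_comp f g) }
  refine ⟨cut ⋙ Join.mapPair l Xr, ?_⟩
  have key : Join.mapPair l Xr ⋙ joinFunctor b = uncut ⋙ X := by
    rw [hα]
    refine CategoryTheory.Functor.ext (fun x ↦ ?_) ?_
    · cases x <;> rfl
    · intro x y f
      match x, y, f with
      | .left x, .left y, .up f =>
        exact ((Category.id_comp _).trans (Category.comp_id _)).symm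
      | .right x, .right y, .up f =>
        exact ((Category.id_comp _).trans (Category.comp_id _)).symm
      | .left x, .right y, f =>
        refine Eq.trans ?_ ((Category.id_comp _).trans (Category.comp_id _)).symm
        refine Eq.trans ?_ (ha x y).symm
        change (a x c ≫ b.map _) ≫ b.map _ = _
        rw [hα' x y, Category.assoc, ← b.map_comp]
        rfl
  calc cut ⋙ Join.mapPair l Xr ⋙ joinFunctor b = cut ⋙ (uncut ⋙ X) := by rw [key]
    _ = X := congrArg (· ⋙ X) hcut

end Cograph

namespace Cograph

open scoped CategoryTheory.Join
open Simplicial SSet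

variable {T B : Type w} [SmallCategory T] [SmallCategory B] {F : T ⥤ B}

/-- Membership of a chain of morphisms in a subcomplex of the nerve of a cograph. -/
def MemFun (L : (nerve (Cograph F)).Subcomplex) {n : ℕ} (X : Fin (n + 1) ⥤ Cograph F) : Prop :=
  (show (nerve (Cograph F)).obj (.op ⦋n⦌) from X) ∈ L.obj (.op ⦋n⦌)

lemma MemFun.comp {L : (nerve (Cograph F)).Subcomplex} {n r : ℕ} {X : Fin (n + 1) ⥤ Cograph F}
    (h : MemFun L X) (κ : Fin (r + 1) →o Fin (n + 1)) : MemFun L (κ.monotone.functor ⋙ X) :=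
  L.map (show ⦋r⦌ ⟶ ⦋n⦌ from SimplexCategory.Hom.mk κ).op h

/-- Subcomplexes of the nerve of a cograph in which membership is determined by the vertices
lying in the base. -/
structure IsBaseClosed (L : (nerve (Cograph F)).Subcomplex) : Prop where
  top : ∀ {n : ℕ} (X : Fin (n + 1) ⥤ Cograph F), (∀ i, ∃ t, X.obj i = top t) → MemFun L X
  base : ∀ {n r : ℕ} (X : Fin (n + 1) ⥤ Cograph F) (θ : Fin (r + 1) →o Fin (n + 1)),
    (∀ i, (¬ ∃ t, X.obj i = .top t) → ∃ k, θ k = i) →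
      MemFun L (θ.monotone.functor ⋙ X) → MemFun L X

section Step

variable {L : (nerve (Cograph F)).Subcomplex} (hL : IsBaseClosed L) {q : ℕ} {b : Fin (q + 1) ⥤ B}
  (hb : ¬ MemFun L (b ⋙ inclBase F))
  (hmin : ∀ r < q, ∀ b' : Fin (r + 1) ⥤ B, MemFun L (b' ⋙ inclBase F))

include hmin in
lemma memFun_of_not_surjective {n : ℕ} (κ : Fin (n + 1) →o Fin (q + 1))
    (hκ : ¬ Function.Surjective κ) : MemFun L (κ.monotone.functor ⋙ b ⋙ inclBase F) := by
  obtain _ | q := q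
  · exact (hκ fun x ↦ ⟨0, Subsingleton.elim (α := Fin 1) _ _⟩).elim
  · obtain ⟨i, θ, hθ⟩ := SimplexCategory.eq_comp_δ_of_not_surjective
      (SimplexCategory.Hom.mk (a := ⦋n⦌) (b := ⦋q + 1⦌) κ) hκ
    have hκ' : κ = (SimplexCategory.δ i).toOrderHom.comp θ.toOrderHom :=
      congrArg SimplexCategory.Hom.toOrderHom hθ
    subst hκ'
    exact (hmin q (by lia) ((SimplexCategory.δ i).toOrderHom.monotone.functor ⋙ b)).comp
      θ.toOrderHom

include hb hmin in
lemma eq_id_of_comp_eq (κ : Fin (q + 1) →o Fin (q + 1))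
    (hκ : κ.monotone.functor ⋙ b ⋙ inclBase F = b ⋙ inclBase F) (x : Fin (q + 1)) : κ x = x := by
  have hs : Function.Surjective κ := by
    by_contra hs
    exact hb (hκ ▸ memFun_of_not_surjective hmin κ hs)
  have hi : StrictMono κ := κ.monotone.strictMono_of_injective (Finite.injective_iff_surjective.2 hs)
  have : StrictMono.orderIsoOfSurjective κ hi hs = OrderIso.refl _ := Subsingleton.elim _ _
  exact congr($this x)

lemma exists_section_joinBoundary {n : ℕ} {S : Type w} [SmallCategory S]
    {v : Fin (n + 1) ⥤ S ⋆ Fin (q + 1)}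
    (m : Fin (q + 1) → Fin (n + 1)) (hm : ∀ j, v.obj (m j) = Join.right j) : Monotone m := by
  intro j j' h
  refine (le_total (m j) (m j')).elim id fun h' ↦ ?_
  have f := v.map (homOfLE h')
  rw [hm, hm] at f
  have hj : j' ≤ j := ((Join.inclRight S (Fin (q + 1))).preimage
    (show (Join.inclRight S (Fin (q + 1))).obj j' ⟶ (Join.inclRight S (Fin (q + 1))).obj j from f)).le
  rw [le_antisymm h hj]

lemma comp_eq_of_section {n : ℕ} {v : Fin (n + 1) ⥤ CostructuredArrow F (b.obj 0) ⋆ Fin (q + 1)}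
    (m : Fin (q + 1) →o Fin (n + 1)) (hm : ∀ j, v.obj (m j) = Join.right j) :
    m.monotone.functor ⋙ v ⋙ joinFunctor b = b ⋙ inclBase F := by
  obtain ⟨X, hX⟩ := exists_comp_eq_of_full (m.monotone.functor ⋙ v) (Join.inclRight _ _)
    (fun j ↦ ⟨j, (hm j).symm⟩)
  have hX' : X = 𝟭 _ := functor_ext_of_thin fun j ↦
    Join.right.inj ((Functor.congr_obj hX j).trans (hm j))
  subst hX'
  exact congrArg (· ⋙ joinFunctor b) hX.symm

include hb in
lemma mem_joinBoundary_of_memFun {n : ℕ}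
    (v : Fin (n + 1) ⥤ CostructuredArrow F (b.obj 0) ⋆ Fin (q + 1))
    (h : MemFun L (v ⋙ joinFunctor b)) : ∃ j : Fin (q + 1), ∀ i, v.obj i ≠ Join.right j := by
  by_contra! hn
  choose m hm using hn
  refine hb ?_
  rw [← comp_eq_of_section ⟨m, exists_section_joinBoundary m hm⟩ hm]
  exact h.comp _

lemma not_isTop_joinFunctor {x : CostructuredArrow F (b.obj 0) ⋆ Fin (q + 1)} :
    (¬ ∃ t, (joinFunctor b).obj x = top t) ↔ ∃ j, x = Join.right j := by
  match x with
  | .left x => exact ⟨fun h ↦ (h ⟨_, rfl⟩).elim, by simp⟩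
  | .right j => exact ⟨fun _ ↦ ⟨j, rfl⟩, fun _ ⟨t, ht⟩ ↦ by cases ht⟩

lemma exists_first {n : ℕ} (X : Fin (n + 1) ⥤ Cograph F) (h : ¬ ∀ i, ∃ t, X.obj i = top t) :
    ∃ c, (¬ ∃ t, X.obj c = top t) ∧ ∀ i, (¬ ∃ t, X.obj i = top t) ↔ c ≤ i := by
  obtain ⟨i, hi⟩ := not_forall.1 h
  obtain ⟨c, hc, hmin⟩ := wellFounded_lt.has_min {i | ¬ ∃ t, X.obj i = top t} ⟨i, hi⟩
  refine ⟨c, hc, fun i ↦ ⟨fun h ↦ not_lt.1 (hmin i h), fun h h' ↦ ?_⟩⟩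
  exact hc (isTop_of_hom (X.map (homOfLE h)) h')

include hL hmin in
lemma memFun_of_mem_joinBoundary {n : ℕ}
    (v : Fin (n + 1) ⥤ CostructuredArrow F (b.obj 0) ⋆ Fin (q + 1))
    (h : ∃ j : Fin (q + 1), ∀ i, v.obj i ≠ Join.right j) : MemFun L (v ⋙ joinFunctor b) := by
  by_cases ht : ∀ i, ∃ t, (v ⋙ joinFunctor b).obj i = top t
  · exact hL.top _ ht
  · obtain ⟨c, -, hc⟩ := exists_first _ ht
    let ρ : Fin (n + 1) →o Fin (n + 1) := ⟨fun i ↦ max i c, fun i j h ↦ max_le_max h le_rfl⟩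
    obtain ⟨X, hX⟩ := exists_comp_eq_of_full (ρ.monotone.functor ⋙ v) (Join.inclRight _ _) (by
      intro i
      obtain ⟨j, hj⟩ := not_isTop_joinFunctor.1 ((hc (max i c)).2 (le_max_right _ _))
      exact ⟨j, hj.symm⟩)
    refine hL.base _ ρ (fun i hi ↦ ⟨i, max_eq_left ((hc i).1 hi)⟩) ?_
    have e : ρ.monotone.functor ⋙ v ⋙ joinFunctor b = X ⋙ b ⋙ inclBase F :=
      congrArg (· ⋙ joinFunctor b) hX.symm
    rw [e]
    refine memFun_of_not_surjective hmin ⟨X.obj, X.monotone⟩ fun hs ↦ ?_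
    obtain ⟨j, hj⟩ := h
    obtain ⟨i, rfl⟩ := hs j
    exact hj (ρ i) (Functor.congr_obj hX i).symm

lemma map_heq_of_comp_eq {A C D : Type*} [Category* A] [Category* C] [Category* D] {X X' : A ⥤ C}
    {ι : C ⥤ D} (h : X ⋙ ι = X' ⋙ ι) {i j : A} (f : i ⟶ j) :
    HEq (ι.map (X.map f)) (ι.map (X'.map f)) := Functor.hcongr_hom h f

lemma heq_of_map_heq {C D : Type*} [Category* C] [Category* D] (ι : C ⥤ D) [ι.Faithful]
    {x y x' y' : C} (hx : x = x') (hy : y = y') {f : x ⟶ y} {f' : x' ⟶ y'}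
    (h : HEq (ι.map f) (ι.map f')) : HEq f f' := by
  subst hx hy
  exact heq_of_eq (ι.map_injective (eq_of_heq h))

include hb hmin in
lemma joinFunctor_injective {n : ℕ}
    (v v' : Fin (n + 1) ⥤ CostructuredArrow F (b.obj 0) ⋆ Fin (q + 1))
    (hv : ¬ ∃ j : Fin (q + 1), ∀ i, v.obj i ≠ Join.right j)
    (h : v ⋙ joinFunctor b = v' ⋙ joinFunctor b) : v = v' := by
  classical
  push Not at hv
  choose m hm using hv
  have hright : ∀ i j, v.obj i = .right j → ∃ j', v'.obj i = .right j' := fun i j hj ↦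
    not_isTop_joinFunctor.1 (by
      have := Functor.congr_obj h i
      dsimp at this
      rw [← this]
      exact not_isTop_joinFunctor.2 ⟨j, hj⟩)
  have hleft : ∀ i s, v.obj i = .left s → ∃ s', v'.obj i = .left s' := by
    intro i s hs
    have e : (joinFunctor b).obj (v.obj i) = (joinFunctor b).obj (v'.obj i) :=
      Functor.congr_obj h i
    generalize v'.obj i = x' at e ⊢
    match x' with
    | .left s' => exact ⟨s', rfl⟩
    | .right j => rw [hs] at e; cases e
  have hr : ∀ i j, v.obj i = .right j → v'.obj i = .right j := by
    intro i j hij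
    let m' := Function.update m j i
    have hm' : ∀ k, v.obj (m' k) = .right k := by
      intro k
      by_cases hk : k = j
      · subst hk; simpa [m'] using hij
      · simpa [m', hk] using hm k
    let m'' : Fin (q + 1) →o Fin (n + 1) := ⟨m', exists_section_joinBoundary m' hm'⟩
    obtain ⟨κ, hκ⟩ := exists_comp_eq_of_full (m''.monotone.functor ⋙ v') (Join.inclRight _ _) (by
      intro k
      obtain ⟨j', hj'⟩ := hright _ _ (hm' k)
      exact ⟨j', hj'.symm⟩)
    have e := comp_eq_of_section m'' hm'
    rw [h] at e
    have e' : m''.monotone.functor ⋙ v' ⋙ joinFunctor b = κ ⋙ b ⋙ inclBase F :=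
      congrArg (· ⋙ joinFunctor b) hκ.symm
    have := eq_id_of_comp_eq hb hmin ⟨κ.obj, κ.monotone⟩ (e'.symm.trans e) j
    have h₁ : κ.obj j = j := this
    have h₂ : (Join.right (κ.obj j) : CostructuredArrow F (b.obj 0) ⋆ Fin (q + 1)) =
      v'.obj (m' j) := Functor.congr_obj hκ j
    rw [h₁] at h₂
    simpa [m'] using h₂.symm
  have hobj : ∀ i, v.obj i = v'.obj i := by
    intro i
    cases hi : v.obj i with
    | right j => exact (hr i j hi).symm
    | left s =>
      rw [← hi]
      have hle : i ≤ m 0 := (le_total i (m 0)).resolve_right fun hle ↦ by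
        have f := v.map (homOfLE hle)
        rw [hi, hm] at f
        exact Join.false_of_right_to_left f
      exact joinFunctor_ext_left b (v.map (homOfLE hle)) (v'.map (homOfLE hle)) (hm 0)
        (hr _ _ (hm 0)) ⟨⟨s, hi⟩, hleft i s hi⟩ (Functor.congr_obj h i) (map_heq_of_comp_eq h _)
  refine Functor.hext hobj fun i j f ↦ ?_
  exact heq_of_map_heq (joinFunctor b) (hobj i) (hobj j) (map_heq_of_comp_eq h f)

end Step

end Cograph

namespace Cograph

open scoped CategoryTheory.Join
open Simplicial SSet

variable {T B : Type w} [SmallCategory T] [SmallCategory B] {F : T ⥤ B}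

/-- The subcomplex of the nerve of the cograph obtained by adding the chains that factor
through `joinFunctor b`. -/
def attach (L : (nerve (Cograph F)).Subcomplex) {q : ℕ} (b : Fin (q + 1) ⥤ B) :
    (nerve (Cograph F)).Subcomplex where
  obj m := {X | X ∈ L.obj m ∨ ∃ v, (nerveMap (joinFunctor b)).app m v = X}
  map θ := by
    rintro X (hX | ⟨v, rfl⟩)
    · exact .inl (L.map θ hX)
    · exact .inr ⟨(nerve _).map θ v, rfl⟩

lemma isBaseClosed_attach {L : (nerve (Cograph F)).Subcomplex} (hL : IsBaseClosed L) {q : ℕ}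
    {b : Fin (q + 1) ⥤ B}
    (hmin : ∀ r < q, ∀ b' : Fin (r + 1) ⥤ B, MemFun L (b' ⋙ inclBase F)) :
    IsBaseClosed (attach L b) where
  top X hX := .inl (hL.top X hX)
  base {n r} X θ hθ h := by
    by_cases hLX : MemFun L (θ.monotone.functor ⋙ X)
    · exact .inl (hL.base X θ hθ hLX)
    obtain ⟨v, hv⟩ : ∃ v : Fin (r + 1) ⥤ CostructuredArrow F (b.obj 0) ⋆ Fin (q + 1),
      v ⋙ joinFunctor b = θ.monotone.functor ⋙ X := h.resolve_left hLX
    have hv' : ¬ ∃ j : Fin (q + 1), ∀ i, v.obj i ≠ Join.right j := fun h ↦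
      hLX (hv ▸ memFun_of_mem_joinBoundary hL hmin v h)
    push Not at hv'
    choose m hm using hv'
    have hvX : ∀ k, (joinFunctor b).obj (v.obj k) = X.obj (θ k) := fun k ↦ Functor.congr_obj hv k
    have hfirst : ∀ i : {i // ¬ ∃ t, X.obj i = Cograph.top t},
        ∃ k, θ k = i.1 ∧ ∀ k', θ k' = i.1 → k ≤ k' := by
      intro i
      obtain ⟨k, hk, hk'⟩ := wellFounded_lt.has_min {k | θ k = i.1} (hθ _ i.2)
      exact ⟨k, hk, fun k' h ↦ not_lt.1 (hk' k' h)⟩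
    choose ξ hξ hξmin using hfirst
    have hξmono : Monotone ξ := by
      intro i j hij
      by_contra! hlt
      have h₁ := θ.monotone hlt.le
      rw [hξ, hξ] at h₁
      obtain rfl : i = j := le_antisymm hij h₁
      exact lt_irrefl _ hlt
    obtain ⟨Xr, hXr⟩ := exists_comp_eq_of_full (hξmono.functor ⋙ v) (Join.inclRight _ _) (by
      intro i
      obtain ⟨j, hj⟩ := not_isTop_joinFunctor.1 (show ¬ ∃ t, (joinFunctor b).obj (v.obj (ξ i)) =
        Cograph.top t by rw [hvX, hξ]; exact i.2)
      exact ⟨j, hj.symm⟩)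
    have hXr' : Xr ⋙ b ⋙ inclBase F = (Subtype.mono_coe _).functor ⋙ X := by
      have h₁ : Xr ⋙ b ⋙ inclBase F = hξmono.functor ⋙ v ⋙ joinFunctor b :=
        congrArg (· ⋙ joinFunctor b) hXr
      have h₂ : hξmono.functor ⋙ θ.monotone.functor = (Subtype.mono_coe _).functor :=
        functor_ext_of_thin hξ
      rw [h₁, hv]
      exact congrArg (· ⋙ X) h₂
    have hnt : ¬ ∃ t, X.obj (θ (m 0)) = Cograph.top t := by
      rw [← hvX]
      exact not_isTop_joinFunctor.2 ⟨0, hm 0⟩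
    obtain ⟨c, hc, hcle⟩ := exists_first X fun h ↦ hnt (h _)
    refine .inr (exists_comp_joinFunctor X b Xr hXr' ⟨c, hc⟩ (fun i ↦ (hcle _).1 i.2) ?_)
    have hle : ξ ⟨c, hc⟩ ≤ m 0 := by
      by_contra! hlt
      have h₁ := θ.monotone hlt.le
      rw [hξ] at h₁
      exact hlt.not_ge (hξmin ⟨c, hc⟩ _ (le_antisymm h₁ ((hcle _).1 hnt)))
    have hright : (Join.right (Xr.obj ⟨c, hc⟩) : CostructuredArrow F (b.obj 0) ⋆ Fin (q + 1)) =
      v.obj (ξ ⟨c, hc⟩) := Functor.congr_obj hXr _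
    have f := v.map (homOfLE hle)
    rw [← hright, hm] at f
    exact le_antisymm ((Join.inclRight (CostructuredArrow F (b.obj 0)) (Fin (q + 1))).preimage
      (show (Join.inclRight _ (Fin (q + 1))).obj _ ⟶ (Join.inclRight _ (Fin (q + 1))).obj 0
        from f)).le (Fin.zero_le _)

lemma exists_minimal_base {L : (nerve (Cograph F)).Subcomplex} (hL : IsBaseClosed L)
    (hne : L ≠ ⊤) : ∃ (q : ℕ) (b : Fin (q + 1) ⥤ B), ¬ MemFun L (b ⋙ inclBase F) ∧
      ∀ r < q, ∀ b' : Fin (r + 1) ⥤ B, MemFun L (b' ⋙ inclBase F) := by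
  classical
  have hex : ∃ q, ∃ b : Fin (q + 1) ⥤ B, ¬ MemFun L (b ⋙ inclBase F) := by
    by_contra! hall
    refine hne (top_le_iff.1 fun m X _ ↦ ?_)
    induction m using Opposite.rec with | op m
    induction m using SimplexCategory.rec with | _ n
    change Fin (n + 1) ⥤ Cograph F at X
    change MemFun L X
    by_cases ht : ∀ i, ∃ t, X.obj i = Cograph.top t
    · exact hL.top X ht
    obtain ⟨c, -, hc⟩ := exists_first X ht
    let ρ : Fin (n + 1) →o Fin (n + 1) := ⟨fun i ↦ max i c, fun i j h ↦ max_le_max h le_rfl⟩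
    obtain ⟨b, hb⟩ := exists_comp_eq_of_full (ρ.monotone.functor ⋙ X) (inclBase F) (by
      intro i
      obtain ⟨b, hb⟩ := not_isTop_iff.1 ((hc (max i c)).2 (le_max_right _ _))
      exact ⟨b, hb.symm⟩)
    refine hL.base _ ρ (fun i hi ↦ ⟨i, max_eq_left ((hc i).1 hi)⟩) ?_
    rw [← hb]
    exact hall n b
  obtain ⟨b, hb⟩ := Nat.find_spec hex
  refine ⟨Nat.find hex, b, hb, fun r hr b' ↦ ?_⟩
  have := Nat.find_min hex hr
  push Not at this
  exact this b'

/-- The subcomplex of chains of morphisms of the source of the functor. -/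
def topSubcomplex (F : T ⥤ B) : (nerve (Cograph F)).Subcomplex where
  obj m := {X | ∃ v, (nerveMap (inclTop F)).app m v = X}
  map θ := by
    rintro X ⟨v, rfl⟩
    exact ⟨(nerve _).map θ v, rfl⟩

lemma isBaseClosed_topSubcomplex : IsBaseClosed (topSubcomplex F) := by
  have h : ∀ {n : ℕ} (X : Fin (n + 1) ⥤ Cograph F), (∀ i, ∃ t, X.obj i = top t) →
      MemFun (topSubcomplex F) X := fun X hX ↦
    exists_comp_eq_of_full X (inclTop F) fun i ↦ by
      obtain ⟨t, ht⟩ := hX i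
      exact ⟨t, ht.symm⟩
  refine ⟨h, fun X θ hθ ⟨v, hv⟩ ↦ h X fun i ↦ ?_⟩
  by_contra hi
  obtain ⟨k, rfl⟩ := hθ i hi
  exact hi ⟨_, (Functor.congr_obj hv k).symm⟩

open SSet.modelCategoryQuillen in
lemma topSubcomplex_anodyne
    (hF : ∀ b, ∃ (s : CostructuredArrow F b) (c : CostructuredArrow F b ⥤ CostructuredArrow F b),
      Nonempty ((Functor.const _).obj s ⟶ c) ∧ Nonempty (𝟭 _ ⟶ c)) :
    anodyneExtensions (topSubcomplex F).ι := by
  refine anodyne_of_exhaustion {L | IsBaseClosed L} _ isBaseClosed_topSubcomplex ?_ ?_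
  · rintro c hc - ⟨L₁, hL₁⟩
    constructor
    · intro n X hX
      change _ ∈ (sSup c).obj _
      rw [Subfunctor.sSup_obj]
      exact ⟨_, ⟨L₁, hL₁, rfl⟩, (hc hL₁).top X hX⟩
    · intro n r X θ hθ h
      change _ ∈ (sSup c).obj _ at h
      change _ ∈ (sSup c).obj _
      rw [Subfunctor.sSup_obj] at h ⊢
      obtain ⟨_, ⟨L, hL, rfl⟩, h⟩ := h
      exact ⟨_, ⟨L, hL, rfl⟩, (hc hL).base X θ hθ h⟩
  · intro L hL hne
    obtain ⟨q, b, hb, hmin⟩ := exists_minimal_base hL hne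
    have hle : L ≤ attach L b := fun m X hX ↦ .inl hX
    have hlt : L < attach L b := lt_of_le_of_ne hle fun h ↦ hb (by
      have : MemFun (attach L b) (b ⋙ inclBase F) := .inr ⟨Join.inclRight _ _, rfl⟩
      rwa [← h] at this)
    refine ⟨_, isBaseClosed_attach hL hmin, hlt, ?_⟩
    obtain ⟨s, c, ⟨z⟩, ⟨z'⟩⟩ := hF (b.obj 0)
    refine anodyne_homOfLE_of_attach L _ _ (joinBoundary (CostructuredArrow F (b.obj 0)) q)
      (joinBoundary_anodyne z z') (nerveMap (joinFunctor b)) ?_ (fun m z ↦ Iff.rfl) ?_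
    · intro m X
      induction m using Opposite.rec with | op m
      induction m using SimplexCategory.rec with | _ n
      exact ⟨memFun_of_mem_joinBoundary hL hmin X, mem_joinBoundary_of_memFun hb X⟩
    · intro m X Y hX h
      induction m using Opposite.rec with | op m
      induction m using SimplexCategory.rec with | _ n
      exact joinFunctor_injective hb hmin X Y hX h

lemma weq_nerveMap_inclTop
    (hF : ∀ b, ∃ (s : CostructuredArrow F b) (c : CostructuredArrow F b ⥤ CostructuredArrow F b),
      Nonempty ((Functor.const _).obj s ⟶ c) ∧ Nonempty (𝟭 _ ⟶ c)) :
    IsWeakHomotopyEquiv (nerveMap (inclTop F)) := by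
  have hmono : Mono (nerveMap (inclTop F)) := by
    have : ∀ m, Mono ((nerveMap (inclTop F)).app m) := fun m ↦
      (mono_iff_injective _).2 fun X Y h ↦ comp_left_injective _ (inclTop_injective F) h
    exact NatTrans.mono_of_mono_app _
  let e : nerve T ⟶ (topSubcomplex F : SSet) :=
    mkHom (fun m X ↦ ⟨(nerveMap (inclTop F)).app m X, ⟨X, rfl⟩⟩) (fun _ _ _ _ ↦ rfl)
  have he : ∀ m, IsIso (e.app m) := fun m ↦ (isIso_iff_bijective _).2
    ⟨fun X Y h ↦ comp_left_injective _ (inclTop_injective F) (congrArg Subtype.val h),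
      fun ⟨_, X, hX⟩ ↦ ⟨X, Subtype.ext hX⟩⟩
  have : IsIso e := NatIso.isIso_of_isIso_app e
  refine IsWeakHomotopyEquiv.of_anodyne fun P Q p hp ↦ ?_
  have := topSubcomplex_anodyne hF p hp
  exact inferInstanceAs (HasLiftingProperty (e ≫ (topSubcomplex F).ι) p)

end Cograph

/-- A variant of Quillen's Theorem A. -/
theorem weq_nerveMap_of_contractible_costructuredArrow {T B : Type w} [SmallCategory T]
    [SmallCategory B] (F : T ⥤ B)
    (hF : ∀ b, ∃ (s : CostructuredArrow F b) (c : CostructuredArrow F b ⥤ CostructuredArrow F b),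
      Nonempty ((Functor.const _).obj s ⟶ c) ∧ Nonempty (𝟭 _ ⟶ c)) :
    IsWeakHomotopyEquiv (nerveMap F) := 
  (Cograph.weq_nerveMap_inclTop hF).comp (Cograph.weq_nerveMap_ret F)

section Chains

/-- The nondegenerate simplex category of the nerve of a category: finite chains of composable
morphisms (with the last object of the chain listed first) and inclusions of chains. -/
structure Chain (B : Type w) [SmallCategory B] : Type w where
  length : ℕ
  chain : ComposableArrows Bᵒᵖ length

namespace Chain

variable {A B : Type w} [SmallCategory A] [SmallCategory B]

/-- The inclusions of chains. -/
@[ext]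
structure Hom (x y : Chain B) : Type w where
  emb : Fin (x.length + 1) → Fin (y.length + 1)
  strictMono : StrictMono emb
  comp_chain : strictMono.monotone.functor ⋙ y.chain = x.chain

instance : SmallCategory (Chain B) where
  Hom := Hom
  id x := ⟨id, strictMono_id, rfl⟩
  comp {x y z} f g := ⟨g.emb ∘ f.emb, g.strictMono.comp f.strictMono, by
    rw [← f.comp_chain, ← g.comp_chain]; rfl⟩

@[ext]
lemma hom_ext {x y : Chain B} {f g : x ⟶ y} (h : ∀ i, Hom.emb f i = Hom.emb g i) : f = g :=
  Hom.ext (funext h)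

lemma hom_induction {P : ∀ x y : Chain B, (x ⟶ y) → Prop}
    (h : ∀ (n : ℕ) (y : Chain B) (f : Fin (n + 1) → Fin (y.length + 1)) (hf : StrictMono f),
      P ⟨n, hf.monotone.functor ⋙ y.chain⟩ y ⟨f, hf, rfl⟩) {x y : Chain B} (f : x ⟶ y) :
    P x y f := by
  have : ∀ (n : ℕ) (f : Fin (n + 1) → Fin (y.length + 1)) (hf : StrictMono f)
      (σ : ComposableArrows Bᵒᵖ n) (e : hf.monotone.functor ⋙ y.chain = σ),
      P ⟨n, σ⟩ y ⟨f, hf, e⟩ := by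
    rintro n f hf _ rfl
    exact h n y f hf
  exact this x.length f.emb f.strictMono x.chain f.comp_chain

/-- The last object of a chain. -/
def last : Chain B ⥤ B where
  obj x := (x.chain.obj 0).unop
  map {x y} f := eqToHom (by rw [← f.comp_chain]; rfl) ≫
    (y.chain.map (homOfLE (Fin.zero_le (f.emb 0)))).unop
  map_id x := by
    refine (Category.id_comp _).trans ?_
    exact congrArg Quiver.Hom.unop (x.chain.map_id 0)
  map_comp {x y z} f g := by
    induction f using hom_induction with | h n y f hf
    induction g using hom_induction with | h m z g hg
    refine (Category.id_comp _).trans ?_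
    refine Eq.trans ?_ (congrArg₂ (· ≫ ·) (Category.id_comp _) (Category.id_comp _)).symm
    exact congrArg Quiver.Hom.unop (z.chain.map_comp (homOfLE _) (homOfLE _))

lemma last_map {n : ℕ} (y : Chain B) (f : Fin (n + 1) → Fin (y.length + 1))
    (hf : StrictMono f) :
    last.map (X := ⟨n, hf.monotone.functor ⋙ y.chain⟩) (Y := y) ⟨f, hf, rfl⟩ =
      (y.chain.map (homOfLE (Fin.zero_le (f 0)))).unop := Category.id_comp _

/-- The functoriality of chains. -/
def map (U : A ⥤ B) : Chain A ⥤ Chain B where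
  obj x := ⟨x.length, x.chain ⋙ U.op⟩
  map {x y} f := ⟨f.emb, f.strictMono, by rw [← f.comp_chain]; rfl⟩

lemma map_last (U : A ⥤ B) : map U ⋙ last = last ⋙ U := by
  refine CategoryTheory.Functor.ext (fun _ ↦ rfl) ?_
  intro x y f
  induction f using hom_induction with | h n y f hf
  refine Eq.trans ?_ ((Category.id_comp _).trans (Category.comp_id _)).symm
  refine (last_map ((map U).obj y) f hf).trans ?_
  exact congrArg U.map (last_map y f hf).symm

lemma precomp_map_zero_succ {n : ℕ} (σ : ComposableArrows Bᵒᵖ n) {b : Bᵒᵖ} (f : b ⟶ σ.obj 0)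
    (k : Fin (n + 1)) :
    (σ.precomp f).map (homOfLE (Fin.zero_le k.succ)) = f ≫ σ.map (homOfLE (Fin.zero_le k)) := by
  obtain ⟨_ | k, hk⟩ := k
  · change f = f ≫ σ.map (𝟙 _)
    simp
  · rfl

/-- Extend an order embedding by one element at the bottom. -/
def consEmb {n m : ℕ} (f : Fin n → Fin m) : Fin (n + 1) → Fin (m + 1) :=
  Fin.cons 0 (Fin.succ ∘ f)

lemma consEmb_strictMono {n m : ℕ} {f : Fin n → Fin m} (hf : StrictMono f) :
    StrictMono (consEmb f) := by
  intro i j h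
  induction j using Fin.cases with
  | zero => simp at h
  | succ j =>
    induction i using Fin.cases with
    | zero => simp [consEmb]
    | succ i => simpa [consEmb] using hf (Fin.succ_lt_succ_iff.1 h)

lemma consEmb_comp_precomp {n m : ℕ} {f : Fin (n + 1) → Fin (m + 1)} (hf : StrictMono f)
    (τ : ComposableArrows Bᵒᵖ m) {b : Bᵒᵖ} (g : b ⟶ τ.obj 0) :
    (consEmb_strictMono hf).monotone.functor ⋙ τ.precomp g =
      ComposableArrows.precomp (hf.monotone.functor ⋙ τ)
        (g ≫ τ.map (homOfLE (Fin.zero_le (f 0)))) := by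
  refine ComposableArrows.ext_succ rfl rfl ?_
  refine Eq.trans ?_ ((Category.id_comp _).trans (Category.comp_id _)).symm
  exact precomp_map_zero_succ τ g (f 0)

/-- Appending an object to a chain. -/
def cons (x : Chain B) {b : B} (f : last.obj x ⟶ b) : Chain B :=
  ⟨x.length + 1, x.chain.precomp f.op⟩

lemma consEmb_comp_cons {x y : Chain B} (θ : x ⟶ y) {b : B} (g : last.obj y ⟶ b) :
    (consEmb_strictMono θ.strictMono).monotone.functor ⋙ (cons y g).chain =
      (cons x (last.map θ ≫ g)).chain := by
  induction θ using hom_induction with | h n y f hf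
  rw [last_map]
  exact consEmb_comp_precomp hf y.chain g.op

/-- The functoriality of appending an object. -/
def consMap {x y : Chain B} (θ : x ⟶ y) {b : B} {f : last.obj x ⟶ b} {g : last.obj y ⟶ b}
    (h : last.map θ ≫ g = f) : cons x f ⟶ cons y g :=
  ⟨consEmb θ.emb, consEmb_strictMono θ.strictMono, by subst h; exact consEmb_comp_cons θ g⟩

lemma last_map_of_emb_zero {x y : Chain B} (θ : x ⟶ y) (h : θ.emb 0 = 0)
    (e : last.obj x = last.obj y) : last.map θ = eqToHom e := by
  induction θ using hom_induction with | h n y f hf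
  rw [last_map]
  dsimp at h
  have : homOfLE (Fin.zero_le (f 0)) = eqToHom h.symm := Subsingleton.elim _ _
  rw [this, eqToHom_map, eqToHom_unop]
  rfl

lemma last_map_consMap {x y : Chain B} (θ : x ⟶ y) {b : B} {f : last.obj x ⟶ b}
    {g : last.obj y ⟶ b} (h : last.map θ ≫ g = f) :
    last.map (consMap θ h) = 𝟙 b := by
  have := last_map_of_emb_zero (consMap θ h) rfl rfl
  exact this

/-- The inclusion of a chain in the chain with an object appended. -/
def toCons (x : Chain B) {b : B} (f : last.obj x ⟶ b) : x ⟶ cons x f :=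
  ⟨Fin.succ, Fin.strictMono_succ, rfl⟩

lemma last_map_toCons (x : Chain B) {b : B} (f : last.obj x ⟶ b) :
    last.map (toCons x f) = f := by
  refine (last_map (cons x f) Fin.succ Fin.strictMono_succ).trans ?_
  rfl

/-- The chain with one object. -/
def single (b : B) : Chain B := ⟨0, .mk₀ (.op b)⟩

/-- The inclusion of the last object in a chain. -/
def singleToCons (x : Chain B) {b : B} (f : last.obj x ⟶ b) : single b ⟶ cons x f :=
  ⟨fun _ ↦ 0, Subsingleton.strictMono (α := Fin 1) _, ComposableArrows.ext₀ rfl⟩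

lemma last_map_singleToCons (x : Chain B) {b : B} (f : last.obj x ⟶ b) :
    last.map (singleToCons x f) = 𝟙 b := by
  have := last_map_of_emb_zero (singleToCons x f) rfl rfl
  exact this

/-- Appending an object to all chains over it. -/
def append (b : B) : CostructuredArrow (last (B := B)) b ⥤ CostructuredArrow (last (B := B)) b where
  obj x := CostructuredArrow.mk (S := last) (Y := cons x.left x.hom) (𝟙 b)
  map {x y} f := CostructuredArrow.homMk (consMap f.left (CostructuredArrow.w f)) (by
    refine (Category.comp_id _).trans (last_map_consMap _ _))
  map_id x := CostructuredArrow.hom_ext _ _ (hom_ext fun i ↦ by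
    induction i using Fin.cases <;> rfl)
  map_comp f g := CostructuredArrow.hom_ext _ _ (hom_ext fun i ↦ by
    induction i using Fin.cases <;> rfl)

/-- The inclusion of chains in appended chains. -/
def toAppend (b : B) : 𝟭 (CostructuredArrow (last (B := B)) b) ⟶ append b where
  app x := CostructuredArrow.homMk (toCons x.left x.hom)
    ((Category.comp_id _).trans (last_map_toCons _ _))
  naturality _ _ _ := CostructuredArrow.hom_ext _ _ (hom_ext fun _ ↦ rfl)

/-- The inclusion of the last object in appended chains. -/
def constToAppend (b : B) : (Functor.const _).obj (CostructuredArrow.mk (S := last)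
    (Y := single b) (𝟙 b)) ⟶ append b where
  app x := CostructuredArrow.homMk (singleToCons x.left x.hom)
    ((Category.comp_id _).trans (last_map_singleToCons _ _))
  naturality _ _ _ := CostructuredArrow.hom_ext _ _ (hom_ext fun _ ↦ rfl)

lemma weq_nerveMap_last : IsWeakHomotopyEquiv (nerveMap (last (B := B))) :=
  weq_nerveMap_of_contractible_costructuredArrow _ fun b ↦
    ⟨_, append b, ⟨constToAppend b⟩, ⟨toAppend b⟩⟩

lemma length_le_of_hom {x y : Chain B} (f : x ⟶ y) : x.length ≤ y.length := by
  have := Fintype.card_le_of_injective _ f.strictMono.injective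
  simpa using this

lemma eq_id_of_length_eq {x y : Chain B} (f : x ⟶ y) (h : x.length = y.length) :
    (⟨x, f⟩ : Σ x, (x ⟶ y)) = ⟨y, 𝟙 y⟩ := by
  induction f using hom_induction with | h n y f hf
  obtain ⟨m, τ⟩ := y
  dsimp at h
  subst h
  have hf' : f = id := by
    have := congrArg DFunLike.coe (Subsingleton.elim
      (hf.orderIsoOfSurjective f (Finite.injective_iff_surjective.1 hf.injective))
      (OrderIso.refl _))
    exact this
  subst hf'
  rfl

instance (y : Chain B) : Finite (Σ x : Chain B, (x ⟶ y)) := by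
  let Φ : (Σ x : Chain B, (x ⟶ y)) →
      Σ n : Fin (y.length + 1), (Fin (n.1 + 1) → Fin (y.length + 1)) := fun p ↦
    ⟨⟨p.1.length, Nat.lt_succ_of_le (length_le_of_hom p.2)⟩, p.2.emb⟩
  refine Finite.of_injective Φ ?_
  rintro ⟨x, f⟩ ⟨x', f'⟩ h
  induction f using hom_induction with | h n y f hf
  induction f' using hom_induction with | h n' y f' hf'
  obtain ⟨h₁, h₂⟩ := Sigma.mk.inj h
  obtain rfl : n = n' := congrArg Fin.val h₁
  obtain rfl : f = f' := eq_of_heq h₂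
  rfl

end Chain

end Chains

namespace ModelStructure

variable {𝓜 : Type u} [Category.{v} 𝓜] (M : ModelStructure 𝓜)

lemma llp_fib_iff {X Y : 𝓜} (f : X ⟶ Y) : M.Fib.llp f ↔ M.Cof f ∧ M.W f := by
  refine ⟨fun hf ↦ ?_, fun hf _ _ p hp ↦ M.lifting_acof_fib f p hf.1 hf.2 hp⟩
  obtain ⟨Z, i, p, hi, hi', hp, fac⟩ := M.fact_acof_fib f
  have := hf p hp
  have sq : CommSq i f p (𝟙 Y) := ⟨by simpa using fac⟩
  have hr : IsRetractOf f i := ⟨𝟙 X, 𝟙 X, sq.lift, p, by simp, sq.fac_right, by simp, by simpa using fac.symm⟩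
  exact ⟨M.Cof_retract hr hi, M.W_retract hr hi'⟩

lemma fibrant_of_iso [HasTerminal 𝓜] {X Y : 𝓜} (e : X ≅ Y) (hY : Fibrant M Y) : Fibrant M X :=
  M.Fib_retract ⟨e.hom, e.inv, 𝟙 _, 𝟙 _, by simp, by simp, terminal.hom_ext _ _,
    terminal.hom_ext _ _⟩ hY

end ModelStructure

section FibrantReplacement

variable {T : Type w} [SmallCategory T] (rk : T → ℕ)
variable {𝓜 : Type u} [Category.{v} 𝓜]

/-- The morphisms to `z` from objects of rank `n`. -/
abbrev CellIndex (n : ℕ) (z : T) : Type w := {p : Σ x : T, (x ⟶ z) // rk p.1 = n}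

variable [HasFiniteColimits 𝓜] [∀ z : T, Finite (Σ x : T, (x ⟶ z))]

/-- The value at `z` of the functor freely generated by objects at the spots of rank `n`. -/
noncomputable def cellObj (G : T → 𝓜) (n : ℕ) (z : T) : 𝓜 :=
  ∐ fun p : CellIndex rk n z ↦ G p.1.1

/-- The inclusions of the summands. -/
noncomputable def cellι (G : T → 𝓜) {n : ℕ} {x z : T} (f : x ⟶ z) (h : rk x = n) :
    G x ⟶ cellObj rk G n z :=
  Sigma.ι (fun p : CellIndex rk n z ↦ G p.1.1) ⟨⟨x, f⟩, h⟩

variable {rk}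

/-- The morphisms out of the coproduct of the cells. -/
noncomputable def cellDesc {G : T → 𝓜} {n : ℕ} {z : T} {Y : 𝓜}
    (g : ∀ (x : T) (_ : x ⟶ z) (_ : rk x = n), G x ⟶ Y) : cellObj rk G n z ⟶ Y :=
  Sigma.desc fun p ↦ g p.1.1 p.1.2 p.2

@[simp]
lemma cellι_cellDesc {G : T → 𝓜} {n : ℕ} {z : T} {Y : 𝓜}
    (g : ∀ (x : T) (_ : x ⟶ z) (_ : rk x = n), G x ⟶ Y) {x : T} (f : x ⟶ z) (h : rk x = n) :
    cellι rk G f h ≫ cellDesc g = g x f h := Sigma.ι_desc _ _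

@[simp]
lemma cellι_cellDesc_assoc {G : T → 𝓜} {n : ℕ} {z : T} {Y Z : 𝓜}
    (g : ∀ (x : T) (_ : x ⟶ z) (_ : rk x = n), G x ⟶ Y) {x : T} (f : x ⟶ z) (h : rk x = n)
    (k : Y ⟶ Z) : cellι rk G f h ≫ cellDesc g ≫ k = g x f h ≫ k := by
  rw [← Category.assoc, cellι_cellDesc]

@[ext]
lemma cell_hom_ext {G : T → 𝓜} {n : ℕ} {z : T} {Y : 𝓜} {g g' : cellObj rk G n z ⟶ Y}
    (h : ∀ (x : T) (f : x ⟶ z) (h : rk x = n), cellι rk G f h ≫ g = cellι rk G f h ≫ g') :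
    g = g' := Sigma.hom_ext _ _ fun p ↦ h p.1.1 p.1.2 p.2

variable (rk)

/-- The functor freely generated by objects at the spots of rank `n`. -/
@[simps]
noncomputable def cellFunctor (G : T → 𝓜) (n : ℕ) : T ⥤ 𝓜 where
  obj z := cellObj rk G n z
  map h := cellDesc fun _ f hx ↦ cellι rk G (f ≫ h) hx

variable {rk}

lemma isIso_cellι (hid : ∀ {x y : T} (f : x ⟶ y), rk x = rk y →
    (⟨x, f⟩ : Σ x, (x ⟶ y)) = ⟨y, 𝟙 y⟩) (G : T → 𝓜) {n : ℕ} {z : T} (h : rk z = n) :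
    IsIso (cellι rk G (𝟙 z) h) := by
  subst h
  refine ⟨cellDesc fun x f hx ↦ eqToHom (congrArg (fun p ↦ G p.1) (hid f hx)), by simp, ?_⟩
  ext x f hx
  have h := hid f hx
  obtain rfl : x = z := congrArg Sigma.fst h
  obtain rfl : f = 𝟙 x := eq_of_heq (Sigma.mk.inj h).2
  simp

variable (M : ModelStructure 𝓜) [HasTerminal 𝓜]

lemma exists_fibrant_at_rank (hid : ∀ {x y : T} (f : x ⟶ y), rk x = rk y →
    (⟨x, f⟩ : Σ x, (x ⟶ y)) = ⟨y, 𝟙 y⟩) (n : ℕ) (D : T ⥤ 𝓜) :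
    ∃ (D' : T ⥤ 𝓜) (η : D ⟶ D'), (∀ z, M.Fib.llp (η.app z)) ∧
      ∀ z, rk z = n → Fibrant M (D'.obj z) := by
  have hF : ∀ x, ∃ (Fx : 𝓜) (j : D.obj x ⟶ Fx), M.Fib.llp j ∧ Fibrant M Fx := by
    intro x
    obtain ⟨Z, i, p, hi, hi', hp, -⟩ := M.fact_acof_fib (terminal.from (D.obj x))
    refine ⟨Z, i, (M.llp_fib_iff _).2 ⟨hi, hi'⟩, ?_⟩
    rwa [show p = terminal.from Z from Subsingleton.elim _ _] at hp
  choose G j hj hG using hF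
  let α : cellFunctor rk D.obj n ⟶ D :=
    { app := fun z ↦ cellDesc fun _ f _ ↦ D.map f
      naturality := fun z z' k ↦ by
        have : (cellDesc fun _ f hx ↦ cellι rk D.obj (f ≫ k) hx : cellObj rk D.obj n z ⟶ _) ≫
            (cellDesc fun _ f _ ↦ D.map f) = (cellDesc fun _ f _ ↦ D.map f) ≫ D.map k := by
          ext; simp
        exact this }
  let β : cellFunctor rk D.obj n ⟶ cellFunctor rk G n :=
    { app := fun z ↦ cellDesc fun x f h ↦ j x ≫ cellι rk G f h
      naturality := fun z z' k ↦ by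
        have : (cellDesc fun _ f hx ↦ cellι rk D.obj (f ≫ k) hx : cellObj rk D.obj n z ⟶ _) ≫
            (cellDesc fun x f h ↦ j x ≫ cellι rk G f h) =
            (cellDesc fun x f h ↦ j x ≫ cellι rk G f h : _ ⟶ cellObj rk G n z) ≫
              (cellDesc fun _ f hx ↦ cellι rk G (f ≫ k) hx) := by
          ext; simp
        exact this }
  have sq : ∀ z, IsPushout (α.app z) (β.app z) ((pushout.inl α β).app z)
    ((pushout.inr α β).app z) := fun z ↦
      (IsPushout.of_hasPushout α β).map ((evaluation T 𝓜).obj z)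
  have hβ : ∀ z, M.Fib.llp (β.app z) := fun z _ _ p hp ↦ by
    have : ∀ q : CellIndex rk n z, HasLiftingProperty (j q.1.1) p := fun q ↦ hj _ p hp
    exact inferInstanceAs (HasLiftingProperty (Limits.Sigma.map
      fun q : CellIndex rk n z ↦ j q.1.1) p)
  refine ⟨pushout α β, pushout.inl α β, fun z ↦ M.Fib.llp.of_isPushout (sq z) (hβ z),
    fun z hz ↦ ?_⟩
  have h₁ := isIso_cellι hid D.obj hz
  have h₂ := isIso_cellι hid G hz
  have h₃ : IsIso (α.app z) := by
    have : cellι rk D.obj (𝟙 z) hz ≫ α.app z = 𝟙 _ := by simp [α]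
    have h₄ : IsIso (cellι rk D.obj (𝟙 z) hz ≫ α.app z) := by rw [this]; infer_instance
    exact IsIso.of_isIso_comp_left (cellι rk D.obj (𝟙 z) hz) _
  have h₄ : IsIso ((pushout.inr α β).app z) := (sq z).isIso_inr_of_isIso
  exact M.fibrant_of_iso
    ((asIso (cellι rk G (𝟙 z) hz)).trans (@asIso _ _ _ _ _ h₄)).symm (hG z)

lemma exists_fibrant_replacement (hid : ∀ {x y : T} (f : x ⟶ y), rk x = rk y →
    (⟨x, f⟩ : Σ x, (x ⟶ y)) = ⟨y, 𝟙 y⟩) (hrk : ∀ {x y : T}, (x ⟶ y) → rk x ≤ rk y)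
    (D : T ⥤ 𝓜) :
    ∃ (D' : T ⥤ 𝓜) (η : D ⟶ D'), ∀ z, M.Cof (η.app z) ∧ M.W (η.app z) ∧
      Fibrant M (D'.obj z) := by
  choose N η hη hN using exists_fibrant_at_rank (rk := rk) M hid
  let X : ℕ → T ⥤ 𝓜 := fun n ↦ Nat.rec D (fun n D ↦ N n D) n
  let S : ℕ ⥤ T ⥤ 𝓜 := Functor.ofSequence (X := X) fun n ↦ η n (X n)
  have hS : ∀ (n m : ℕ) (h : n ≤ m) (z : T), M.Fib.llp ((S.map (homOfLE h)).app z) := by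
    intro n m h z
    induction m, h using Nat.le_induction with
    | base => 
      have : S.map (homOfLE (le_refl n)) = 𝟙 _ := S.map_id n
      rw [this]
      exact MorphismProperty.id_mem _ _
    | succ m h ih =>
      have : S.map (homOfLE (Nat.le_succ_of_le h)) = S.map (homOfLE h) ≫ η m (X m) := by
        rw [← Functor.ofSequence_map_homOfLE_succ (X := X) fun n ↦ η n (X n)]
        exact S.map_comp (homOfLE h) (homOfLE m.le_succ)
      rw [this]
      exact MorphismProperty.comp_mem _ _ _ ih (hη _ _ _)
  refine ⟨
    { obj := fun z ↦ (S.obj (rk z + 1)).obj z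
      map := fun {z z'} f ↦ (S.map (homOfLE (Nat.succ_le_succ (hrk f)))).app z ≫
        (S.obj (rk z' + 1)).map f
      map_id := ?_
      map_comp := ?_ },
    { app := fun z ↦ (S.map (homOfLE (Nat.zero_le (rk z + 1)))).app z
      naturality := ?_ }, fun z ↦ ?_⟩
  · intro z
    simp
  · intro z z' z'' f g
    have : S.map (homOfLE (Nat.succ_le_succ (hrk (f ≫ g)))) = S.map (homOfLE (Nat.succ_le_succ (hrk f))) ≫
        S.map (homOfLE (Nat.succ_le_succ (hrk g))) := S.map_comp (homOfLE _) (homOfLE _)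
    simp [this]
  · intro z z' f
    have : S.map (homOfLE (Nat.zero_le (rk z' + 1))) = S.map (homOfLE (Nat.zero_le (rk z + 1))) ≫
        S.map (homOfLE (Nat.succ_le_succ (hrk f))) := S.map_comp (homOfLE _) (homOfLE _)
    dsimp
    rw [this]
    rw [NatTrans.comp_app]
    have h₁ := (S.map (homOfLE (Nat.zero_le (rk z + 1)))).naturality f
    have h₂ := (S.map (homOfLE (Nat.succ_le_succ (hrk f)))).naturality f
    rw [← h₂]
    erw [← Category.assoc, ← Category.assoc, ← h₁]
    rfl
  · have := (M.llp_fib_iff _).1 (hS _ _ (Nat.zero_le (rk z + 1)) z)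
    exact ⟨this.1, this.2, hN _ _ z rfl⟩

end FibrantReplacement

lemma IsWeakHomotopyEquiv.of_comp_left {X Y Z : SSet.{w}} {f : X ⟶ Y} {g : Y ⟶ Z}
    (hf : IsWeakHomotopyEquiv f) (hfg : IsWeakHomotopyEquiv (f ≫ g)) :
    IsWeakHomotopyEquiv g := by
  intro K hK
  refine ⟨fun k ↦ ?_, fun h h' H ↦ (hfg K hK).2 h h' ?_⟩
  · obtain ⟨h, hh⟩ := (hfg K hK).1 (f ≫ k)
    exact ⟨h, (hf K hK).2 _ _ (by simpa using hh)⟩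
  · simpa using H.comp_left f

section AcyclicExtensions

variable {E : Type u} [Category.{v} E] {X : Type (max u v)} [Category.{max u v} X]

/-- An acyclic cofibration out of the object `ev.obj pt`. -/
structure AcycExt (ME : ModelDiag E) (ev : X ⥤ E) : Type (max u v) where
  pt : X
  cod : E
  hom : ev.obj pt ⟶ cod
  weq : ME.W hom
  cof : ME.C hom

namespace AcycExt

variable {ME : ModelDiag E} {ev : X ⥤ E}

/-- Morphisms of acyclic cofibrations. -/
@[ext]
structure Hom (p q : AcycExt ME ev) : Type (max u v) where
  base : p.pt ⟶ q.pt
  top : p.cod ⟶ q.cod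
  comm : p.hom ≫ top = ev.map base ≫ q.hom

instance : Category.{max u v} (AcycExt ME ev) where
  Hom := Hom
  id p := ⟨𝟙 _, 𝟙 _, by simp⟩
  comp f g := ⟨f.base ≫ g.base, f.top ≫ g.top, by
    rw [← Category.assoc, f.comm, Category.assoc, g.comm, ev.map_comp, Category.assoc]⟩
  id_comp _ := Hom.ext (Category.id_comp _) (Category.id_comp _)
  comp_id _ := Hom.ext (Category.comp_id _) (Category.comp_id _)
  assoc _ _ _ := Hom.ext (Category.assoc _ _ _) (Category.assoc _ _ _)

variable (ME ev) in
/-- The underlying point. -/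
def forget : AcycExt ME ev ⥤ X where
  obj p := p.pt
  map f := f.base

variable (ME ev) in
/-- The codomain of the acyclic cofibration. -/
def codomain : AcycExt ME ev ⥤ E where
  obj p := p.cod
  map f := f.top

variable (ME ev) in
/-- The trivial acyclic cofibrations. -/
def trivial : X ⥤ AcycExt ME ev where
  obj x := ⟨x, ev.obj x, 𝟙 _, ME.W_id _, ME.C_id _⟩
  map f := ⟨f, ev.map f, by simp⟩
  map_id x := Hom.ext rfl (ev.map_id x)
  map_comp f g := Hom.ext rfl (ev.map_comp f g)

lemma weq_nerveMap_forget : IsWeakHomotopyEquiv (nerveMap (forget ME ev)) :=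
  weq_nerveMap_of_section (G := trivial ME ev) rfl (.inl ⟨
    { app := fun p ↦ ⟨𝟙 _, p.hom, by simp [trivial, forget]⟩
      naturality := fun _ _ f ↦ Hom.ext ((Category.comp_id _).trans (Category.id_comp _).symm)
        f.comm.symm }⟩)

section Extend

variable {T : Type*} [Category* T] {L : T ⥤ AcycExt ME ev} {K : T ⥤ E}
  (θ : L ⋙ codomain ME ev ⟶ K) (hW : ∀ t, ME.W (θ.app t)) (hC : ∀ t, ME.C (θ.app t))

/-- Enlarging the codomains of a diagram of acyclic cofibrations. -/
def extend : T ⥤ AcycExt ME ev where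
  obj t := ⟨(L.obj t).pt, K.obj t, (L.obj t).hom ≫ θ.app t, ME.W_comp _ _ (L.obj t).weq (hW t),
    ME.C_comp _ _ (L.obj t).cof (hC t)⟩
  map {t t'} f := ⟨(L.map f).base, K.map f, by
    have h₁ := θ.naturality f
    have h₂ := (L.map f).comm
    dsimp [codomain] at h₁ h₂ ⊢
    rw [Category.assoc, ← h₁, ← Category.assoc, h₂, Category.assoc]⟩
  map_id t := Hom.ext (congrArg (fun f ↦ Hom.base f) (L.map_id t) :) (K.map_id t)
  map_comp f g := Hom.ext (congrArg (fun f ↦ Hom.base f) (L.map_comp f g) :) (K.map_comp f g)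

/-- The inclusion into the enlargement. -/
def toExtend : L ⟶ extend θ hW hC where
  app t := ⟨𝟙 _, θ.app t, by simp [extend]⟩
  naturality t t' f := Hom.ext ((Category.comp_id _).trans (Category.id_comp _).symm)
    (θ.naturality f)

end Extend

variable (ME ev) in
/-- The acyclic cofibrations with fibrant codomain. -/
abbrev Fib : Type (max u v) :=
  ObjectProperty.FullSubcategory fun p : AcycExt ME ev ↦ FibrantObj ME p.cod

lemma weq_nerveMap_ι (h : ∃ (K : Chain (AcycExt ME ev) ⥤ E)
    (θ : Chain.last ⋙ codomain ME ev ⟶ K), ∀ t, ME.W (θ.app t) ∧ ME.C (θ.app t) ∧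
      FibrantObj ME (K.obj t)) :
    IsWeakHomotopyEquiv (nerveMap (ObjectProperty.ι _ : Fib ME ev ⥤ AcycExt ME ev)) := by
  obtain ⟨K, θ, h⟩ := h
  let ι : Fib ME ev ⥤ AcycExt ME ev := ObjectProperty.ι _
  let R : Chain (AcycExt ME ev) ⥤ Fib ME ev :=
    ObjectProperty.lift _ (extend θ (fun t ↦ (h t).1) (fun t ↦ (h t).2.1)) fun t ↦ (h t).2.2
  let α : Chain.last ⟶ R ⋙ ι := toExtend θ (fun t ↦ (h t).1) fun t ↦ (h t).2.1
  let fι : ι.FullyFaithful := ObjectProperty.fullyFaithfulι _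
  let β : Chain.last ⟶ Chain.map ι ⋙ R :=
    (fι.whiskeringRight (Chain (Fib ME ev))).preimage
      (eqToHom (Chain.map_last ι).symm ≫ Functor.whiskerLeft (Chain.map ι) α)
  have h₁ : IsWeakHomotopyEquiv (nerveMap R ≫ nerveMap ι) :=
    Chain.weq_nerveMap_last.of_htpy (shomotopy_nerveMap α).htpy
  have h₂ : IsWeakHomotopyEquiv (nerveMap (Chain.map ι) ≫ nerveMap R) :=
    Chain.weq_nerveMap_last.of_htpy (shomotopy_nerveMap β).htpy
  exact (h₂.of_two_of_six h₁).of_comp_left h₁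

end AcycExt

end AcyclicExtensions

section CollageFibrant

variable {C : Type u} {D : Type u} [Category.{v} C] [Category.{v} D]
  {MC : ModelStructure C} {MD : ModelStructure D} (Q : QuillenAdjunction MC MD) (PC : C → Prop)

/-- The inclusion of the right fiber in the collage. -/
def collageInr (G : D ⥤ C) (PC : C → Prop) : D ⥤ Collage G PC (fun _ ↦ True) where
  obj y := Sum.inr ⟨y, trivial⟩
  map f := f
  map_id _ := rfl
  map_comp _ _ := rfl

instance (G : D ⥤ C) : (collageInr G PC).Full where
  map_surjective f := ⟨f, rfl⟩

instance (G : D ⥤ C) : (collageInr G PC).Faithful where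
  map_injective h := h

/-- The terminal object of the collage. -/
noncomputable def isTerminalInr [HasTerminal D] :
    IsTerminal ((collageInr Q.G PC).obj (⊤_ D)) := by
  have hT : IsTerminal (Q.G.obj (⊤_ D)) := by
    have := Q.adj.rightAdjoint_preservesLimits
    exact terminalIsTerminal.isTerminalObj Q.G _
  refine IsTerminal.ofUniqueHom (fun X ↦ match X with
    | Sum.inl x => hT.from x.1
    | Sum.inr y => terminal.from y.1) ?_
  rintro (x | y) m
  · exact hT.hom_ext _ _
  · exact terminal.hom_ext (C := D) _ _

lemma fibrantObj_collageInr [HasTerminal D] {y : D} (hy : Fibrant MD y) :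
    FibrantObj (collageDiag Q PC fun _ ↦ True) ((collageInr Q.G PC).obj y) := by
  refine ⟨_, isTerminalInr Q PC, ?_⟩
  have : (isTerminalInr Q PC).from ((collageInr Q.G PC).obj y) =
    (collageInr Q.G PC).map (terminal.from y) := (isTerminalInr Q PC).hom_ext _ _
  rw [this]
  exact hy

lemma exists_collageInr_iff {X Y : Collage Q.G PC (fun _ ↦ True)} {f : X ⟶ Y}
    (hf : (collageDiag Q PC fun _ ↦ True).W f) :
    (∃ y, (collageInr Q.G PC).obj y = X) ↔ ∃ y, (collageInr Q.G PC).obj y = Y := by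
  rcases X with x | x <;> rcases Y with y | y
  · simp [collageInr]
  · exact hf.elim
  · exact hf.elim
  · exact ⟨fun _ ↦ ⟨y.1, rfl⟩, fun _ ↦ ⟨x.1, rfl⟩⟩

lemma exists_collageInr_of_eqvGen {I : Type u} [Category.{v} I] {MI : ModelDiag I} {a t : I}
    (h : Relation.EqvGen (fun p q : I ↦ ∃ f : p ⟶ q, MI.W f) a t)
    (X : MDHom MI (collageDiag Q PC fun _ ↦ True)) :
    (∃ y, (collageInr Q.G PC).obj y = X.func.obj a) ↔
      ∃ y, (collageInr Q.G PC).obj y = X.func.obj t := by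
  induction h with
  | rel a t h => exact exists_collageInr_iff Q PC (X.map_W _ h.choose_spec)
  | refl => exact Iff.rfl
  | symm a t _ h => exact h.symm
  | trans a b c _ _ h h' => exact h.trans h'

lemma exists_fibrant_extension [HasFiniteColimits D] [HasTerminal D] {B : Type w}
    [SmallCategory B] (L : Chain B ⥤ Collage Q.G PC (fun _ ↦ True))
    (hL : ∀ t, ∃ y, (collageInr Q.G PC).obj y = L.obj t) :
    ∃ (K : Chain B ⥤ Collage Q.G PC (fun _ ↦ True)) (θ : L ⟶ K), ∀ t,
      (collageDiag Q PC fun _ ↦ True).W (θ.app t) ∧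
      (collageDiag Q PC fun _ ↦ True).C (θ.app t) ∧
      FibrantObj (collageDiag Q PC fun _ ↦ True) (K.obj t) := by
  obtain ⟨L, rfl⟩ := exists_comp_eq_of_full L (collageInr Q.G PC) hL
  obtain ⟨K, θ, h⟩ := exists_fibrant_replacement MD
    (fun f h ↦ Chain.eq_id_of_length_eq f h) (fun f ↦ Chain.length_le_of_hom f) L
  exact ⟨K ⋙ collageInr Q.G PC, Functor.whiskerRight θ _, fun t ↦
    ⟨(h t).2.1, (h t).1, fibrantObj_collageInr Q PC (h t).2.2⟩⟩

end CollageFibrant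

lemma map_heq_map {A : Type*} {B : Type*} [Category* A] [Category* B] (F : A ⥤ B)
    {X Y X' Y' : A} {f : X ⟶ Y} {g : X' ⟶ Y'} (hX : X = X') (hY : Y = Y') (h : HEq f g) :
    HEq (F.map f) (F.map g) := by
  subst hX hY
  rw [eq_of_heq h]

section FreeExtension

variable {I : Type u} {J : Type u} {E : Type u} [Category.{v} I] [Category.{v} J] [Category.{v} E]

/-- The universal property of the model diagram obtained by freely adjoining an acyclic
cofibration out of `a`. -/
def IsFreeExtension {MI : ModelDiag I} {MJ : ModelDiag J} (φ : MDHom MI MJ) {a : I} {u : J}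
    (w₁ : φ.func.obj a ⟶ u) : Prop :=
  ∀ (E : Type u) [Category.{v} E] (ME : ModelDiag E) (X : MDHom MI ME)
    (uE : E) (f : X.func.obj a ⟶ uE), ME.W f → ME.C f →
    ∃! Y : MDHom MJ ME, φ.comp Y = X ∧ Y.func.obj u = uE ∧ HEq (Y.func.map w₁) f

namespace IsFreeExtension

variable {MI : ModelDiag I} {MJ : ModelDiag J} {φ : MDHom MI MJ} {a : I} {u : J}
  {w₁ : φ.func.obj a ⟶ u} (h : IsFreeExtension φ w₁)

include h

lemma func_eq {ME : ModelDiag E} {Y Y' : MDHom MJ ME}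
    (hw₁W : MJ.W w₁) (hw₁C : MJ.C w₁)
    (hφ : φ.func ⋙ Y.func = φ.func ⋙ Y'.func)
    (hu : Y.func.obj u = Y'.func.obj u) (hw : HEq (Y.func.map w₁) (Y'.func.map w₁)) :
    Y.func = Y'.func := by
  have hc : φ.comp Y = φ.comp Y' := by
    simp only [MDHom.comp, hφ]
  rw [(h E ME (φ.comp Y') (Y'.func.obj u) (Y'.func.map w₁) (Y'.map_W _ hw₁W)
    (Y'.map_C _ hw₁C)).unique ⟨hc, hu, hw⟩ ⟨rfl, rfl, HEq.rfl⟩]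

lemma obj_cases (hw₁W : MJ.W w₁) (hw₁C : MJ.C w₁) (j : J) : (∃ i, φ.func.obj i = j) ∨ j = u := by
  let E := InducedCategory (Discrete PUnit.{v + 1}) (fun _ : ULift.{u} Prop ↦ ⟨⟨⟩⟩)
  let ME : ModelDiag E :=
    { W := ⊤, C := ⊤, F := ⊤
      W_id := fun _ ↦ trivial
      C_id := fun _ ↦ trivial
      F_id := fun _ ↦ trivial
      W_comp := fun _ _ _ _ ↦ trivial
      C_comp := fun _ _ _ _ ↦ trivial
      F_comp := fun _ _ _ _ ↦ trivial
      W_of_precomp := fun _ _ _ _ ↦ trivial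
      W_of_postcomp := fun _ _ _ _ ↦ trivial }
  have hE : ∀ (x y : E) (f g : x ⟶ y), f = g := fun x y f g ↦
    InducedCategory.hom_ext (Subsingleton.elim _ _)
  have hE' : ∀ {x y x' y' : E} (_ : x = x') (_ : y = y') (f : x ⟶ y) (g : x' ⟶ y'),
      HEq f g := by
    rintro x y _ _ rfl rfl f g
    exact heq_of_eq (hE _ _ _ _)
  let Y (P : J → Prop) : MDHom MJ ME :=
    { func :=
        { obj := fun j ↦ ULift.up (P j)
          map := fun _ ↦ ⟨𝟙 _⟩
          map_id := fun _ ↦ hE _ _ _ _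
          map_comp := fun _ _ ↦ hE _ _ _ _ }
      map_W := fun _ _ ↦ trivial
      map_C := fun _ _ ↦ trivial
      map_F := fun _ _ ↦ trivial }
  have key := h.func_eq (Y := Y fun j ↦ (∃ i, φ.func.obj i = j) ∨ j = u) (Y' := Y fun _ ↦ True)
    hw₁W hw₁C ?_ ?_ ?_
  · have := congrArg ULift.down (congrArg (fun F : J ⥤ E ↦ F.obj j) key)
    exact of_eq_true this
  · refine CategoryTheory.Functor.ext (fun i ↦ ?_) (fun _ _ _ ↦ hE _ _ _ _)
    exact ULift.ext _ _ (eq_true (.inl ⟨i, rfl⟩))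
  · exact ULift.ext _ _ (eq_true (.inr rfl))
  · have h₁ : ((∃ i, φ.func.obj i = φ.func.obj a) ∨ φ.func.obj a = u) = True :=
      eq_true (.inl ⟨a, rfl⟩)
    have h₂ : ((∃ i, φ.func.obj i = u) ∨ u = u) = True := eq_true (.inr rfl)
    exact hE' (ULift.ext _ _ h₁) (ULift.ext _ _ h₂) _ _

lemma natTrans_ext (hw₁W : MJ.W w₁) (hw₁C : MJ.C w₁) {Y Y' : J ⥤ E} {η η' : Y ⟶ Y'}
    (hφ : ∀ i, η.app (φ.func.obj i) = η'.app (φ.func.obj i)) (hu : η.app u = η'.app u) :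
    η = η' := by
  ext j
  obtain ⟨i, rfl⟩ | rfl := h.obj_cases hw₁W hw₁C j
  · exact hφ i
  · exact hu

variable {ME : ModelDiag E} (Y Y' : MDHom MJ ME) (f : φ.func ⋙ Y.func ⟶ φ.func ⋙ Y'.func)
  (g : Y.func.obj u ⟶ Y'.func.obj u)

omit h in
/-- The arrows of `E` which are components of a transformation. -/
def arrowFamily : Option I → Arrow E
  | some i => Arrow.mk (f.app i)
  | none => Arrow.mk g

omit h in
/-- The model diagram of arrows of `E` which are components of a transformation. -/
def arrowDiag : ModelDiag (InducedCategory (Arrow E) (arrowFamily Y Y' f g)) where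
  W _ _ m := ME.W m.hom.left ∧ ME.W m.hom.right
  C _ _ m := ME.C m.hom.left ∧ ME.C m.hom.right
  F _ _ m := ME.F m.hom.left ∧ ME.F m.hom.right
  W_id _ := ⟨ME.W_id _, ME.W_id _⟩
  C_id _ := ⟨ME.C_id _, ME.C_id _⟩
  F_id _ := ⟨ME.F_id _, ME.F_id _⟩
  W_comp _ _ h h' := ⟨ME.W_comp _ _ h.1 h'.1, ME.W_comp _ _ h.2 h'.2⟩
  C_comp _ _ h h' := ⟨ME.C_comp _ _ h.1 h'.1, ME.C_comp _ _ h.2 h'.2⟩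
  F_comp _ _ h h' := ⟨ME.F_comp _ _ h.1 h'.1, ME.F_comp _ _ h.2 h'.2⟩
  W_of_precomp _ _ h h' := ⟨ME.W_of_precomp _ _ h.1 h'.1, ME.W_of_precomp _ _ h.2 h'.2⟩
  W_of_postcomp _ _ h h' := ⟨ME.W_of_postcomp _ _ h.1 h'.1, ME.W_of_postcomp _ _ h.2 h'.2⟩

omit h in
/-- The source of the arrows. -/
def arrowSource : MDHom (arrowDiag Y Y' f g) ME where
  func := inducedFunctor _ ⋙ Arrow.leftFunc
  map_W _ h := h.1
  map_C _ h := h.1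
  map_F _ h := h.1

omit h in
/-- The target of the arrows. -/
def arrowTarget : MDHom (arrowDiag Y Y' f g) ME where
  func := inducedFunctor _ ⋙ Arrow.rightFunc
  map_W _ h := h.2
  map_C _ h := h.2
  map_F _ h := h.2

omit h in
/-- The transformation from the source to the target. -/
def arrowTrans : (arrowSource Y Y' f g).func ⟶ (arrowTarget Y Y' f g).func :=
  CategoryTheory.Functor.whiskerLeft (inducedFunctor _) Arrow.leftToRight

omit h in
/-- The diagram of the components of a transformation. -/
def arrowHom : MDHom MI (arrowDiag Y Y' f g) where
  func :=
    { obj := some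
      map := fun m ↦ ⟨Arrow.homMk (u := Y.func.map (φ.func.map m))
        (v := Y'.func.map (φ.func.map m)) (f.naturality m)⟩
      map_id := fun i ↦ InducedCategory.hom_ext (by ext <;> simp [arrowFamily])
      map_comp := fun m m' ↦ InducedCategory.hom_ext (Arrow.hom_ext _ _
        ((congrArg Y.func.map (φ.func.map_comp m m')).trans (Y.func.map_comp _ _))
        ((congrArg Y'.func.map (φ.func.map_comp m m')).trans (Y'.func.map_comp _ _))) }
  map_W m hm := ⟨Y.map_W _ (φ.map_W m hm), Y'.map_W _ (φ.map_W m hm)⟩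
  map_C m hm := ⟨Y.map_C _ (φ.map_C m hm), Y'.map_C _ (φ.map_C m hm)⟩
  map_F m hm := ⟨Y.map_F _ (φ.map_F m hm), Y'.map_F _ (φ.map_F m hm)⟩

lemma exists_natTrans (hw₁W : MJ.W w₁) (hw₁C : MJ.C w₁)
    (hfg : Y.func.map w₁ ≫ g = f.app a ≫ Y'.func.map w₁) :
    ∃ η : Y.func ⟶ Y'.func, (∀ i, η.app (φ.func.obj i) = f.app i) ∧ η.app u = g := by
  let E' := InducedCategory (Arrow E) (arrowFamily Y Y' f g)
  let w : (arrowHom Y Y' f g).func.obj a ⟶ (none : E') :=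
    ⟨Arrow.homMk (u := Y.func.map w₁) (v := Y'.func.map w₁) hfg⟩
  obtain ⟨Z, ⟨hZ, hZu, hZw⟩, -⟩ := h E' (arrowDiag Y Y' f g) (arrowHom Y Y' f g) none w
    ⟨Y.map_W _ hw₁W, Y'.map_W _ hw₁W⟩ ⟨Y.map_C _ hw₁C, Y'.map_C _ hw₁C⟩
  have hZo : ∀ i, Z.func.obj (φ.func.obj i) = some i := fun i ↦
    congrArg (fun X : MDHom MI (arrowDiag Y Y' f g) ↦ X.func.obj i) hZ
  have hS : (Z.comp (arrowSource Y Y' f g)).func = Y.func := by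
    refine h.func_eq hw₁W hw₁C ?_ ?_ ?_
    · exact congrArg (fun X : MDHom MI (arrowDiag Y Y' f g) ↦
        X.func ⋙ (arrowSource Y Y' f g).func) hZ
    · exact congrArg (arrowSource Y Y' f g).func.obj hZu
    · exact map_heq_map (arrowSource Y Y' f g).func (hZo a) hZu hZw
  have hT : (Z.comp (arrowTarget Y Y' f g)).func = Y'.func := by
    refine h.func_eq hw₁W hw₁C ?_ ?_ ?_
    · exact congrArg (fun X : MDHom MI (arrowDiag Y Y' f g) ↦
        X.func ⋙ (arrowTarget Y Y' f g).func) hZ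
    · exact congrArg (arrowTarget Y Y' f g).func.obj hZu
    · exact map_heq_map (arrowTarget Y Y' f g).func (hZo a) hZu hZw
  let η : Y.func ⟶ Y'.func := eqToHom hS.symm ≫
    CategoryTheory.Functor.whiskerLeft Z.func (arrowTrans Y Y' f g) ≫ eqToHom hT
  have hη : ∀ (j : J) (k : E'), Z.func.obj j = k →
      HEq (η.app j) ((arrowTrans Y Y' f g).app k) := by
    rintro j k rfl
    simp only [η, NatTrans.comp_app, eqToHom_app]
    refine (eqToHom_comp_heq _ _).trans ?_
    change HEq ((arrowTrans Y Y' f g).app (Z.func.obj j) ≫ (eqToHom hT).app j) _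
    rw [eqToHom_app]
    exact comp_eqToHom_heq _ _
  exact ⟨η, fun i ↦ eq_of_heq (hη _ _ (hZo i)), eq_of_heq (hη _ _ hZu)⟩

end IsFreeExtension

end FreeExtension

section Comparison

lemma app_eq_eqToHom {A B : Type u} [Category.{v} A] [Category.{v} B] {F G : A ⥤ B} (η : F ⟶ G)
    {p q : A} (e : p = q) {h : F.obj p = G.obj p} (hp : η.app p = eqToHom h)
    (h' : F.obj q = G.obj q) : η.app q = eqToHom h' := by
  subst e
  exact hp

variable {I : Type u} {J : Type u} {E : Type u} [Category.{v} I] [Category.{v} J] [Category.{v} E]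
  {MI : ModelDiag I} {sI tI : I} {MJ : ModelDiag J} {sJ tJ : J}
  (decI : Decor I) (ME : ModelDiag E) (sE tE : E)

/-- Evaluation at an object. -/
def evalStar (MI : ModelDiag I) (sI tI a : I) : FunStar decI MI sI tI ME sE tE ⥤ E where
  obj X := X.obj.func.obj a
  map η := η.hom.1.app a
  map_id _ := rfl
  map_comp _ _ := rfl

variable {decI} {decJ : Decor J} (φ : PtdMDHom MI sI tI MJ sJ tJ) (hφ : DecRespects decI decJ φ)
  {a : I} {u : J} (w₁ : φ.func.obj a ⟶ u) (hw₁W : MJ.W w₁) (hw₁C : MJ.C w₁)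

/-- A diagram on the extension restricts to a diagram together with an acyclic cofibration
with fibrant codomain. -/
def toAcycExt (hu : decJ.fibObj u) : FunStar decJ MJ sJ tJ ME sE tE ⥤
    AcycExt.Fib ME (evalStar decI ME sE tE MI sI tI a) where
  obj Y := ⟨⟨(restrictStar decI decJ φ hφ ME sE tE).obj Y, Y.obj.func.obj u, Y.obj.func.map w₁,
    Y.obj.map_W _ hw₁W, Y.obj.map_C _ hw₁C⟩, Y.property.2.1 u hu⟩
  map η := ObjectProperty.homMk ⟨(restrictStar decI decJ φ hφ ME sE tE).map η, η.hom.1.app u,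
    η.hom.1.naturality w₁⟩
  map_id _ := rfl
  map_comp _ _ := rfl

variable {φ w₁} (h : IsFreeExtension φ.toMDHom w₁) (hu : decJ.fibObj u)

include h

lemma faithful_toAcycExt : (toAcycExt ME sE tE φ hφ w₁ hw₁W hw₁C hu).Faithful where
  map_injective {Y Y' η η'} H := by
    let Θ := toAcycExt ME sE tE φ hφ w₁ hw₁W hw₁C hu
    have h₁ := congrArg (fun m : Θ.obj Y ⟶ Θ.obj Y' ↦ m.hom.base) H
    have h₂ := congrArg (fun m : Θ.obj Y ⟶ Θ.obj Y' ↦ m.hom.top) H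
    apply ObjectProperty.hom_ext
    apply Subtype.ext
    refine h.natTrans_ext hw₁W hw₁C (fun i ↦ ?_) h₂
    exact congrArg (fun m ↦ (evalStar decI ME sE tE MI sI tI i).map m) h₁

lemma full_toAcycExt : (toAcycExt ME sE tE φ hφ w₁ hw₁W hw₁C hu).Full where
  map_surjective {Y Y'} m := by
    obtain ⟨η, hη, hηu⟩ := h.exists_natTrans Y.obj.toMDHom Y'.obj.toMDHom m.hom.base.hom.1
      m.hom.top hw₁W hw₁C m.hom.comm
    have hW : ∀ j, ME.W (η.app j) := by
      intro j
      obtain ⟨i, rfl⟩ | rfl := h.obj_cases hw₁W hw₁C j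
      · rw [hη]
        exact m.hom.base.hom.2.1 i
      · rw [hηu]
        have hc : Y.obj.func.map w₁ ≫ m.hom.top = _ := m.hom.comm
        refine ME.W_of_precomp (Y.obj.func.map w₁) m.hom.top (Y.obj.map_W _ hw₁W) ?_
        rw [hc]
        exact ME.W_comp _ _ (m.hom.base.hom.2.1 a) (Y'.obj.map_W _ hw₁W)
    refine ⟨ObjectProperty.homMk ⟨η, hW, ?_, ?_⟩, ?_⟩
    · exact app_eq_eqToHom η φ.hs ((hη sI).trans m.hom.base.hom.2.2.1) _
    · exact app_eq_eqToHom η φ.ht ((hη tI).trans m.hom.base.hom.2.2.2) _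
    · apply ObjectProperty.hom_ext
      refine AcycExt.Hom.ext ?_ hηu
      apply ObjectProperty.hom_ext
      apply Subtype.ext
      exact NatTrans.ext (funext hη)

lemma essSurj_toAcycExt
    (hdec : ∀ Y : MDHom MJ ME, SatDec decI ME (φ.func ⋙ Y.func) →
      FibrantObj ME (Y.func.obj u) → SatDec decJ ME Y.func) :
    (toAcycExt ME sE tE φ hφ w₁ hw₁W hw₁C hu).EssSurj where
  mem_essImage := by
    rintro ⟨⟨⟨⟨X, hs, ht⟩, hX⟩, e, i, hW, hC⟩, he⟩
    obtain ⟨Y, ⟨rfl, rfl, hi⟩, -⟩ := h E ME X e i hW hC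
    obtain rfl := eq_of_heq hi
    exact ⟨⟨⟨Y, (congrArg Y.func.obj φ.hs.symm).trans hs,
      (congrArg Y.func.obj φ.ht.symm).trans ht⟩, hdec Y hX he⟩,
      ⟨Iso.refl _⟩⟩

end Comparison

/-- let `F : C ⇄ D : G` be a Quillen adjunction and double-point the
collage `(C^c+D)` by a cofibrant object `x ∈ C^c` and an object `y ∈ D`.  Let `I` be a
decorated doubly-pointed model diagram, `a ∈ I` an object connected to `t` by a zigzag of
weak equivalences, and let `J` be obtained from `I` by freely adjoining a new object `u`
marked `fibrant` together with a morphism `a → u` lying in `W ∩ C` (a pushout of model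
diagrams, expressed by its universal property `hUP`; the decoration of `J` is that of `I`
together with the new marking of `u`).  Then restriction along the inclusion `I → J`
induces a weak homotopy equivalence
`N(Fun*_{**}(J,(C^c+D))^W) → N(Fun*_{**}(I,(C^c+D))^W)`. -/
theorem statement8
    {C : Type u} {D : Type u} [Category.{v} C] [Category.{v} D]
    [HasFiniteLimits C] [HasFiniteColimits C] [HasFiniteLimits D] [HasFiniteColimits D]
    {MC : ModelStructure C} {MD : ModelStructure D} (Q : QuillenAdjunction MC MD)
    (x : C) (hx : Cofibrant MC x) (y : D)
    {I : Type u} [Category.{v} I] (MI : ModelDiag I) (sI tI : I) (decI : Decor I)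
    (a : I) (hconn : Relation.EqvGen (fun p q : I => ∃ f : p ⟶ q, MI.W f) a tI)
    {J : Type u} [Category.{v} J] (MJ : ModelDiag J) (sJ tJ : J) (decJ : Decor J)
    (φ : PtdMDHom MI sI tI MJ sJ tJ)
    (u : J) (w₁ : φ.func.obj a ⟶ u) (hw₁W : MJ.W w₁) (hw₁C : MJ.C w₁)
    (hUP : ∀ (E : Type u) [Category.{v} E] (ME : ModelDiag E) (X : MDHom MI ME)
      (uE : E) (f : X.func.obj a ⟶ uE), ME.W f → ME.C f →
      ∃! Y : MDHom MJ ME, φ.toMDHom.comp Y = X ∧ Y.func.obj u = uE ∧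
        HEq (Y.func.map w₁) f)
    (hdecCof : ∀ o, decJ.cofObj o ↔ ∃ i, decI.cofObj i ∧ φ.func.obj i = o)
    (hdecFib : ∀ o, decJ.fibObj o ↔ (o = u ∨ ∃ i, decI.fibObj i ∧ φ.func.obj i = o))
    (hdecPo : ∀ sq, decJ.po sq ↔ ∃ sq₀, decI.po sq₀ ∧ sq₀.fmap φ.func = sq)
    (hdecPb : ∀ sq, decJ.pb sq ↔ ∃ sq₀, decI.pb sq₀ ∧ sq₀.fmap φ.func = sq)
    (hφdec : DecRespects decI decJ φ) :
    IsWeakHomotopyEquiv (nerveMap (restrictStar decI decJ φ hφdec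
      (collageDiag Q (Cofibrant MC) (fun _ => True))
      (Sum.inl ⟨x, hx⟩) (Sum.inr ⟨y, trivial⟩))) := by
  have h : IsFreeExtension φ.toMDHom w₁ := hUP
  have hu : decJ.fibObj u := (hdecFib u).2 (.inl rfl)
  let ME := collageDiag Q (Cofibrant MC) (fun _ => True)
  let sE : Collage Q.G (Cofibrant MC) (fun _ => True) := Sum.inl ⟨x, hx⟩
  let tE : Collage Q.G (Cofibrant MC) (fun _ => True) := Sum.inr ⟨y, trivial⟩
  let Θ := toAcycExt ME sE tE φ hφdec w₁ hw₁W hw₁C hu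
  have : Θ.Faithful := faithful_toAcycExt ME sE tE hφdec hw₁W hw₁C h hu
  have : Θ.Full := full_toAcycExt ME sE tE hφdec hw₁W hw₁C h hu
  have : Θ.EssSurj := by
    refine essSurj_toAcycExt ME sE tE hφdec hw₁W hw₁C h hu fun Y hI hY ↦ ⟨?_, ?_, ?_, ?_⟩
    · intro o ho
      obtain ⟨i, hi, rfl⟩ := (hdecCof o).1 ho
      exact hI.1 i hi
    · intro o ho
      obtain rfl | ⟨i, hi, rfl⟩ := (hdecFib o).1 ho
      · exact hY
      · exact hI.2.1 i hi
    · intro sq hsq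
      obtain ⟨sq, h, rfl⟩ := (hdecPo sq).1 hsq
      exact hI.2.2.1 sq h
    · intro sq hsq
      obtain ⟨sq, h, rfl⟩ := (hdecPb sq).1 hsq
      exact hI.2.2.2 sq h
  have : Θ.IsEquivalence := {}
  let ev := evalStar decI ME sE tE MI sI tI a
  have hι := AcycExt.weq_nerveMap_ι (ME := ME) (ev := ev)
    (exists_fibrant_extension Q _ (Chain.last ⋙ AcycExt.codomain ME ev) fun t ↦
      (exists_collageInr_iff Q _ (Chain.last.obj t).weq).1
        ((exists_collageInr_of_eqvGen Q _ hconn (Chain.last.obj t).pt.obj.toMDHom).2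
          ⟨y, (Chain.last.obj t).pt.obj.ht.symm⟩))
  exact ((weq_nerveMap_of_isEquivalence Θ).comp hι).comp AcycExt.weq_nerveMap_forget

end Paper
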